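/- Suppose s > -1 and 1 ≤ p < ∞, and let u ∈ D'(ℝ^N) satisfy ∇u ∈ (L^p_s)^N. Fix ρ > 0 and set c_u := |B_ρ|^{-1} ∫_{B_ρ} u (which does not depend on s and p). Then u ∈ L^q_{s+1} for every q ∈ I_{1,p}, and for each such q there is a constant C = C(s,p,q) > 0 independent of u such that ||u - c_u||_{L^q_{s+1}} ≤ C ||\,|∇u|\,||_{L^p_s}. Furthermore, if p > N or p = N = 1, then lim_{|x|→∞} |x|^{-(s+1)} u(x) = 0. -/

import Mathlib

open MeasureTheory Metric Filter Topology ENNReal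

noncomputable section

/-- Euclidean space `ℝ^N`. -/
abbrev Euc (N : ℕ) := EuclideanSpace ℝ (Fin N)

/-- Iterated classical partial derivative along a list of coordinate directions. -/
def pderivList {N : ℕ} : List (Fin N) → (Euc N → ℝ) → Euc N → ℝ
  | [], φ => φ
  | i :: l, φ => pderivList l fun x => fderiv ℝ φ x (EuclideanSpace.single i 1)

/-- `g` is the weak (distributional) partial derivative of `u` of order given by the
list `l` of coordinate directions, i.e. `g = ∂_{l₁} ⋯ ∂_{l_r} u` in `D'(ℝ^N)`. -/
def IsWeakDerivList {N : ℕ} (l : List (Fin N)) (u g : Euc N → ℝ) : Prop :=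
  LocallyIntegrable u volume ∧ LocallyIntegrable g volume ∧
    ∀ φ : Euc N → ℝ, ContDiff ℝ (⊤ : ℕ∞) φ → HasCompactSupport φ →
      ∫ x, u x * pderivList l φ x = (-1 : ℝ) ^ l.length * ∫ x, g x * φ x

/-- `g` is the weak partial derivative `∂ᵢ u`. -/
def IsWeakPartialDeriv {N : ℕ} (i : Fin N) (u g : Euc N → ℝ) : Prop :=
  IsWeakDerivList [i] u g

/-- The weight `(1+|x|)^{-s-N/q}` of the space `L^q_s` (with `N/∞ := 0`). -/
def wt (N : ℕ) (s : ℝ) (q : ℝ≥0∞) (x : Euc N) : ℝ :=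
  (1 + ‖x‖) ^ (-s - (N : ℝ) / q.toReal)

/-- Membership in the weighted space `L^q_s`. -/
def MemLs (N : ℕ) (s : ℝ) (q : ℝ≥0∞) (u : Euc N → ℝ) : Prop :=
  MemLp (fun x => wt N s q x * u x) q volume

/-- The norm of the weighted space `L^q_s`. -/
def LsNorm (N : ℕ) (s : ℝ) (q : ℝ≥0∞) (u : Euc N → ℝ) : ℝ :=
  (eLpNorm (fun x => wt N s q x * u x) q volume).toReal

/-- Membership in the exponentially weighted space `L^q_{exp,s}`. -/
def MemLexp (N : ℕ) (s : ℝ) (q : ℝ≥0∞) (u : Euc N → ℝ) : Prop :=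
  MemLp (fun x => Real.exp (-(s * ‖x‖)) * u x) q volume

/-- The norm of the exponentially weighted space `L^q_{exp,s}`. -/
def LexpNorm (N : ℕ) (s : ℝ) (q : ℝ≥0∞) (u : Euc N → ℝ) : ℝ :=
  (eLpNorm (fun x => Real.exp (-(s * ‖x‖)) * u x) q volume).toReal

/-- The pointwise Euclidean (Frobenius) norm `|∇^k u|` of the `k`-th gradient, whose
components `g m` are indexed by the `k`-tuples `m` of coordinate directions. -/
def gradNormK {N k : ℕ} (g : (Fin k → Fin N) → Euc N → ℝ) (x : Euc N) : ℝ :=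
  Real.sqrt (∑ m : Fin k → Fin N, g m x ^ 2)

/-- The pointwise Euclidean norm `|∇u|` of a first-order gradient. -/
def gradNorm1 {N : ℕ} (g : Fin N → Euc N → ℝ) (x : Euc N) : ℝ :=
  Real.sqrt (∑ i, g i x ^ 2)

/-- The interval `I_{j,p}` of admissible exponents `q`. -/
def Ijp (N j : ℕ) (p : ℝ) : Set ℝ≥0∞ :=
  if p = (N : ℝ) / (j : ℝ) ∧ 1 < N then Set.Ico (ENNReal.ofReal p) ⊤
  else if p < (N : ℝ) / (j : ℝ) then
    Set.Icc (ENNReal.ofReal p) (ENNReal.ofReal ((N : ℝ) * p / ((N : ℝ) - (j : ℝ) * p)))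
  else Set.Icc (ENNReal.ofReal p) ⊤

/-- The average of `u` on the ball `B_ρ`. -/
def ballAvg {N : ℕ} (ρ : ℝ) (u : Euc N → ℝ) : ℝ :=
  (volume (ball (0 : Euc N) ρ)).toReal⁻¹ * ∫ y in ball (0 : Euc N) ρ, u y

/-- The radial symmetrization `u_S(x) = (Nω_N)⁻¹ ∫_{S^{N-1}} u(|x|σ) dσ`. -/
def radialSymmetrization {N : ℕ} (u : Euc N → ℝ) (x : Euc N) : ℝ :=
  ((N : ℝ) * (volume (ball (0 : Euc N) 1)).toReal)⁻¹ *
    ∫ σ : sphere (0 : Euc N) 1, u (‖x‖ • (σ : Euc N)) ∂((volume : Measure (Euc N)).toSphere)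

/-- `u` is radially symmetric: `u x` only depends on `|x|`. -/
def RadSymm {N : ℕ} (u : Euc N → ℝ) : Prop :=
  ∀ x y : Euc N, ‖x‖ = ‖y‖ → u x = u y

/-- Evaluation of a polynomial on `ℝ^N` at a point. -/
def polyEval {N : ℕ} (π : MvPolynomial (Fin N) ℝ) (x : Euc N) : ℝ :=
  MvPolynomial.eval (fun i => x i) π


/-! ### Elementary tools -/

lemma aux_rpow_comp {x y K : ℝ} (a : ℝ) (hx : 0 < x) (hy : 0 < y) (hK : 1 ≤ K)
    (h1 : x ≤ K * y) (h2 : y ≤ K * x) : x ^ a ≤ K ^ |a| * y ^ a := by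
  have hK0 : 0 < K := by linarith
  rcases le_total 0 a with ha | ha
  · rw [abs_of_nonneg ha, ← Real.mul_rpow hK0.le hy.le]
    exact Real.rpow_le_rpow hx.le h1 ha
  · rw [abs_of_nonpos ha]
    have h3 : y ^ (-a) ≤ K ^ (-a) * x ^ (-a) := by
      rw [← Real.mul_rpow hK0.le hx.le]
      exact Real.rpow_le_rpow hy.le h2 (by linarith)
    rw [Real.rpow_neg hy.le, Real.rpow_neg hx.le] at h3
    have hxa := Real.rpow_pos_of_pos hx a
    have hya := Real.rpow_pos_of_pos hy a
    have := mul_le_mul_of_nonneg_right h3 (mul_pos hxa hya).le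
    field_simp at this
    linarith

/-- The weight `(1+|x|)^a` as an extended nonnegative real. -/
def Wt {N : ℕ} (a : ℝ) (x : Euc N) : ℝ≥0∞ := ENNReal.ofReal ((1 + ‖x‖) ^ a)

lemma one_add_norm_pos {N : ℕ} (x : Euc N) : 0 < 1 + ‖x‖ := by positivity

@[fun_prop]
lemma measurable_Wt {N : ℕ} (a : ℝ) : Measurable (Wt a : Euc N → ℝ≥0∞) := by
  unfold Wt; fun_prop

lemma Wt_ne_top {N : ℕ} (a : ℝ) (x : Euc N) : Wt a x ≠ ∞ := ENNReal.ofReal_ne_top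

lemma Wt_ne_zero {N : ℕ} (a : ℝ) (x : Euc N) : Wt a x ≠ 0 := by
  unfold Wt
  have := Real.rpow_pos_of_pos (one_add_norm_pos x) a
  simpa using this

lemma Wt_add {N : ℕ} (a b : ℝ) (x : Euc N) : Wt (a + b) x = Wt a x * Wt b x := by
  unfold Wt
  rw [← ENNReal.ofReal_mul (by positivity), Real.rpow_add (one_add_norm_pos x)]

lemma Wt_rpow {N : ℕ} (a : ℝ) {b : ℝ} (hb : 0 ≤ b) (x : Euc N) : Wt a x ^ b = Wt (a * b) x := by
  unfold Wt
  rw [ENNReal.ofReal_rpow_of_nonneg (by positivity) hb, Real.rpow_mul (one_add_norm_pos x).le]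

lemma Wt_zero {N : ℕ} (x : Euc N) : Wt 0 x = 1 := by simp [Wt]

lemma Wt_comp {N : ℕ} (a : ℝ) {K : ℝ} (hK : 1 ≤ K) {x y : Euc N}
    (h1 : 1 + ‖x‖ ≤ K * (1 + ‖y‖)) (h2 : 1 + ‖y‖ ≤ K * (1 + ‖x‖)) :
    Wt a x ≤ ENNReal.ofReal (K ^ |a|) * Wt a y := by
  unfold Wt
  rw [← ENNReal.ofReal_mul (by positivity)]
  exact ENNReal.ofReal_le_ofReal
    (aux_rpow_comp a (one_add_norm_pos x) (one_add_norm_pos y) hK h1 h2)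

lemma lintegral_affine {N : ℕ} (f : Euc N → ℝ≥0∞) (a : Euc N) {r : ℝ} (hr : 0 < r) :
    ∫⁻ x, f (a + r • x) = ENNReal.ofReal (r ^ (-(N : ℝ))) * ∫⁻ x, f x := by
  have h1 : ∫⁻ x, f (a + r • x) = ∫⁻ x, f (a + x) ∂(Measure.map (r • ·) volume) := by
    rw [show (fun x : Euc N => r • x) = (Homeomorph.smulOfNeZero r hr.ne').toMeasurableEquiv from rfl,
      lintegral_map_equiv]
    rfl
  rw [h1, Measure.map_addHaar_smul volume hr.ne', lintegral_smul_measure,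
    lintegral_add_left_eq_self f a]
  have hpos : 0 < r ^ N := by positivity
  simp [abs_of_pos hr, Real.rpow_neg hr.le]

lemma jensen_prob {α : Type*} [MeasurableSpace α] (μ : Measure α) [IsProbabilityMeasure μ]
    {f : α → ℝ≥0∞} (hf : AEMeasurable f μ) {p : ℝ} (hp : 1 ≤ p) :
    (∫⁻ x, f x ∂μ) ^ p ≤ ∫⁻ x, f x ^ p ∂μ := by
  rcases hp.eq_or_lt with rfl | hp
  · simp
  have hc : p.HolderConjugate (p.conjExponent) := Real.HolderConjugate.conjExponent hp
  have := ENNReal.lintegral_mul_le_Lp_mul_Lq μ hc hf (aemeasurable_const (b := (1 : ℝ≥0∞)))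
  simp at this
  calc (∫⁻ x, f x ∂μ) ^ p ≤ ((∫⁻ x, f x ^ p ∂μ) ^ p⁻¹) ^ p := by gcongr
    _ = _ := by rw [← ENNReal.rpow_mul, inv_mul_cancel₀ (by linarith), ENNReal.rpow_one]

/-- weighted Jensen/Hölder on `(0,1)`. -/
lemma holder_unit {f : ℝ → ℝ≥0∞} (hf : Measurable f) {p β : ℝ} (hp : 1 ≤ p) :
    (∫⁻ t in Set.Ioo (0 : ℝ) 1, f t) ^ p ≤
      (∫⁻ t in Set.Ioo (0 : ℝ) 1, ENNReal.ofReal (t ^ (-β))) ^ (p - 1) *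
      ∫⁻ t in Set.Ioo (0 : ℝ) 1, ENNReal.ofReal (t ^ (β * (p - 1))) * f t ^ p := by
  rcases hp.eq_or_lt with rfl | hp
  · simp
  set p' := p.conjExponent with hp'
  have hc : p.HolderConjugate p' := Real.HolderConjugate.conjExponent hp
  have hp'0 : 0 < p' := hc.symm.pos
  have hpp : p / p' = p - 1 := by
    rw [hp']; unfold Real.conjExponent; field_simp
  have h1 : ∫⁻ t in Set.Ioo (0 : ℝ) 1, f t =
      ∫⁻ t in Set.Ioo (0 : ℝ) 1, ((fun t => ENNReal.ofReal (t ^ (β / p')) * f t) *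
        (fun t => ENNReal.ofReal (t ^ (-β / p')))) t := by
    refine setLIntegral_congr_fun measurableSet_Ioo fun t ht => ?_
    have : ENNReal.ofReal (t ^ (β / p')) * ENNReal.ofReal (t ^ (-β / p')) = 1 := by
      rw [← ENNReal.ofReal_mul (Real.rpow_nonneg ht.1.le _), ← Real.rpow_add ht.1]
      simp [← add_div]
    simp only [Pi.mul_apply]
    rw [mul_right_comm, this, one_mul]
  have h2 := ENNReal.lintegral_mul_le_Lp_mul_Lq (volume.restrict (Set.Ioo (0 : ℝ) 1)) hc
    (f := fun t => ENNReal.ofReal (t ^ (β / p')) * f t)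
    (g := fun t => ENNReal.ofReal (t ^ (-β / p'))) (by fun_prop) (by fun_prop)
  rw [← h1] at h2
  have e1 : ∫⁻ t in Set.Ioo (0 : ℝ) 1, (ENNReal.ofReal (t ^ (β / p')) * f t) ^ p =
      ∫⁻ t in Set.Ioo (0 : ℝ) 1, ENNReal.ofReal (t ^ (β * (p - 1))) * f t ^ p := by
    refine setLIntegral_congr_fun measurableSet_Ioo fun t ht => ?_
    rw [ENNReal.mul_rpow_of_nonneg _ _ (by linarith),
      ENNReal.ofReal_rpow_of_nonneg (Real.rpow_nonneg ht.1.le _) (by linarith),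
      ← Real.rpow_mul ht.1.le, div_mul_eq_mul_div, mul_div_assoc, hpp]
  have e2 : ∫⁻ t in Set.Ioo (0 : ℝ) 1, (ENNReal.ofReal (t ^ (-β / p'))) ^ p' =
      ∫⁻ t in Set.Ioo (0 : ℝ) 1, ENNReal.ofReal (t ^ (-β)) := by
    refine setLIntegral_congr_fun measurableSet_Ioo fun t ht => ?_
    rw [ENNReal.ofReal_rpow_of_nonneg (Real.rpow_nonneg ht.1.le _) hp'0.le,
      ← Real.rpow_mul ht.1.le, div_mul_cancel₀ _ hp'0.ne']
  rw [e1, e2] at h2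
  calc (∫⁻ t in Set.Ioo (0 : ℝ) 1, f t) ^ p ≤ _ := ENNReal.rpow_le_rpow h2 (by linarith)
    _ = _ := by
      rw [ENNReal.mul_rpow_of_nonneg _ _ (by linarith), ← ENNReal.rpow_mul, ← ENNReal.rpow_mul,
        one_div_mul_cancel (by linarith), ENNReal.rpow_one, mul_comm, one_div_mul_eq_div, hpp]

lemma lintegral_unit_rpow_lt_top {a : ℝ} (ha : -1 < a) :
    ∫⁻ t in Set.Ioo (0 : ℝ) 1, ENNReal.ofReal (t ^ a) < ∞ := by
  have h := (intervalIntegral.integrableOn_Ioo_rpow_iff (s := a) (t := 1) one_pos).2 ha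
  exact h.lintegral_lt_top

lemma ftc_enorm {N : ℕ} {u : Euc N → ℝ} (hu : ContDiff ℝ 1 u) (x y : Euc N) :
    ‖u x - u y‖ₑ ≤ ENNReal.ofReal ‖x - y‖ *
      ∫⁻ t in Set.Ioo (0 : ℝ) 1, ‖fderiv ℝ u (y + t • (x - y))‖ₑ := by
  have hd : ∀ t : ℝ, HasDerivAt (fun t : ℝ => u (y + t • (x - y)))
      (fderiv ℝ u (y + t • (x - y)) (x - y)) t := by
    intro t
    have h1 : HasDerivAt (fun t : ℝ => y + t • (x - y)) (x - y) t := by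
      simpa using ((hasDerivAt_id t).smul_const (x - y)).const_add y
    exact ((hu.differentiable one_ne_zero).differentiableAt.hasFDerivAt).comp_hasDerivAt t h1
  have hc : Continuous fun t : ℝ => fderiv ℝ u (y + t • (x - y)) (x - y) := by
    have := hu.continuous_fderiv one_ne_zero
    fun_prop
  have h2 := intervalIntegral.integral_eq_sub_of_hasDerivAt (a := 0) (b := 1)
    (fun t _ => hd t) (hc.intervalIntegrable 0 1)
  simp only [one_smul, zero_smul, add_zero, add_sub_cancel] at h2
  rw [← h2, intervalIntegral.integral_of_le zero_le_one, integral_Ioc_eq_integral_Ioo]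
  refine (enorm_integral_le_lintegral_enorm _).trans ?_
  rw [← lintegral_const_mul' _ _ ENNReal.ofReal_ne_top]
  refine lintegral_mono fun t => ?_
  rw [mul_comm, ofReal_norm]
  exact ContinuousLinearMap.le_opENorm _ _

lemma hardy_core {N : ℕ} (ρ e m : ℝ) (hρ : 0 < ρ) (hm : 0 ≤ m) (hem : -1 < e - N + m) :
    ∃ C : ℝ≥0∞, C ≠ ∞ ∧ ∀ H : Euc N → ℝ≥0∞, Measurable H →
      ∫⁻ x : Euc N, ∫⁻ y in ball (0 : Euc N) ρ, ∫⁻ t in Set.Ioo (0 : ℝ) 1,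
        Wt (-e) x * ENNReal.ofReal (t ^ m) * H (y + t • (x - y)) ≤
      C * ∫⁻ z, Wt (-e) z * H z := by
  set K : ℝ := 2 * (2 + ρ) with hK
  have hK1 : 1 ≤ K := by rw [hK]; linarith
  set c1 : ℝ≥0∞ := ENNReal.ofReal (K ^ |(-e)|) with hc1
  set B : Set (Euc N) := ball (0 : Euc N) ρ with hB
  set I1 : ℝ≥0∞ := ∫⁻ t in Set.Ioo (0 : ℝ) 1, ENNReal.ofReal (t ^ (e - N + m)) with hI1
  set I2 : ℝ≥0∞ := ∫⁻ x : Euc N, Wt (-(e + m + 1)) x with hI2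
  have hI1t : I1 ≠ ∞ := (lintegral_unit_rpow_lt_top hem).ne
  have hI2t : I2 ≠ ∞ := by
    refine (finite_integral_one_add_norm (μ := (volume : Measure (Euc N))) ?_).ne
    simp; linarith
  have hBt : volume B ≠ ∞ := measure_ball_lt_top.ne
  refine ⟨c1 * I1 * volume B + c1 * ENNReal.ofReal (2 ^ (N : ℝ)) * I2, ?_, ?_⟩
  · refine ENNReal.add_ne_top.2 ⟨?_, ?_⟩
    · exact ENNReal.mul_ne_top (ENNReal.mul_ne_top ENNReal.ofReal_ne_top hI1t) hBt
    · exact ENNReal.mul_ne_top (ENNReal.mul_ne_top ENNReal.ofReal_ne_top ENNReal.ofReal_ne_top) hI2t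
  intro H hH
  set f : Euc N → ℝ≥0∞ := fun z => Wt (-e) z * H z with hf
  have hfm : Measurable f := by fun_prop
  set J := ∫⁻ z, f z with hJ
  let F1 : Euc N → Euc N → ℝ → ℝ≥0∞ := fun x y t =>
    c1 * ENNReal.ofReal (t ^ (e + m)) * f (y + t • (x - y))
  let F2 : Euc N → Euc N → ℝ → ℝ≥0∞ := fun x y t =>
    (Set.Iio (1 / (2 * (1 + ‖x‖)))).indicator (fun t => c1 * Wt (-e) x * ENNReal.ofReal (t ^ m)) t
      * f (y + t • (x - y))
  have hF1m : Measurable fun q : (Euc N × Euc N) × ℝ => F1 q.1.1 q.1.2 q.2 := by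
    simp only [F1]; fun_prop
  have hF2m : Measurable fun q : (Euc N × Euc N) × ℝ => F2 q.1.1 q.1.2 q.2 := by
    simp only [F2]
    refine Measurable.mul ?_ (by fun_prop)
    have : (fun q : (Euc N × Euc N) × ℝ => (Set.Iio (1 / (2 * (1 + ‖q.1.1‖)))).indicator
        (fun t => c1 * Wt (-e) q.1.1 * ENNReal.ofReal (t ^ m)) q.2) =
      Set.indicator {q : (Euc N × Euc N) × ℝ | q.2 < 1 / (2 * (1 + ‖q.1.1‖))}
        (fun q => c1 * Wt (-e) q.1.1 * ENNReal.ofReal (q.2 ^ m)) := by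
      ext q; simp [Set.indicator]
    rw [this]
    refine Measurable.indicator (by fun_prop) ?_
    exact measurableSet_lt (by fun_prop) (by fun_prop)
  have key : ∀ x : Euc N, ∀ y ∈ B, ∀ t ∈ Set.Ioo (0 : ℝ) 1,
      Wt (-e) x * ENNReal.ofReal (t ^ m) * H (y + t • (x - y)) ≤ F1 x y t + F2 x y t := by
    intro x y hy t ht
    have ht0 := ht.1
    have ht1 := ht.2
    have hyn : ‖y‖ < ρ := by simpa [hB] using hy
    set z := y + t • (x - y) with hz
    have hz1 : ‖z‖ ≤ ρ + t * ‖x‖ := by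
      have : z = (1 - t) • y + t • x := by rw [hz]; module
      rw [this]
      refine (norm_add_le _ _).trans ?_
      rw [norm_smul, norm_smul, Real.norm_of_nonneg (by linarith : 0 ≤ 1 - t),
        Real.norm_of_nonneg ht0.le]
      have : (1 - t) * ‖y‖ ≤ 1 * ρ := by
        apply mul_le_mul (by linarith) hyn.le (norm_nonneg _) zero_le_one
      linarith
    have hz2 : t * ‖x‖ ≤ ‖z‖ + ρ := by
      have : t • x = z - (1 - t) • y := by rw [hz]; module
      have h3 : ‖t • x‖ ≤ ‖z‖ + ‖(1 - t) • y‖ := by rw [this]; exact norm_sub_le _ _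
      rw [norm_smul, norm_smul, Real.norm_of_nonneg (by linarith : 0 ≤ 1 - t),
        Real.norm_of_nonneg ht0.le] at h3
      have : (1 - t) * ‖y‖ ≤ 1 * ρ := by
        apply mul_le_mul (by linarith) hyn.le (norm_nonneg _) zero_le_one
      linarith
    rcases le_or_gt (1 / 2) (t * (1 + ‖x‖)) with hA | hA
    · refine le_trans ?_ le_self_add
      have hX : 0 < t * (1 + ‖x‖) := by linarith
      have h4 := aux_rpow_comp (-e) hX (one_add_norm_pos z) hK1
        (by rw [hK]; nlinarith [norm_nonneg z]) (by rw [hK]; nlinarith)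
      have h5 : Wt (-e) x ≤ c1 * ENNReal.ofReal (t ^ e) * Wt (-e) z := by
        rw [hc1]; unfold Wt
        rw [← ENNReal.ofReal_mul (by positivity), ← ENNReal.ofReal_mul (by positivity)]
        apply ENNReal.ofReal_le_ofReal
        rw [Real.mul_rpow ht0.le (by positivity)] at h4
        have h6 := mul_le_mul_of_nonneg_left h4 (Real.rpow_nonneg ht0.le e)
        rw [← mul_assoc, ← Real.rpow_add ht0] at h6
        simp only [add_neg_cancel, Real.rpow_zero, one_mul] at h6
        linarith
      calc Wt (-e) x * ENNReal.ofReal (t ^ m) * H z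
          ≤ (c1 * ENNReal.ofReal (t ^ e) * Wt (-e) z) * ENNReal.ofReal (t ^ m) * H z := by gcongr
        _ = F1 x y t := by
          simp only [F1, hf]
          rw [Real.rpow_add ht0, ENNReal.ofReal_mul (by positivity)]
          ring
    · refine le_trans ?_ le_add_self
      have hmem : t ∈ Set.Iio (1 / (2 * (1 + ‖x‖))) := by
        rw [Set.mem_Iio, lt_div_iff₀ (by positivity)]; linarith
      simp only [F2]
      rw [Set.indicator_of_mem hmem]
      have h5 : (1 : ℝ≥0∞) ≤ c1 * Wt (-e) z := by
        have := Wt_comp (N := N) (-e) hK1 (x := 0) (y := z)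
          (by simp; nlinarith [norm_nonneg z]) (by simp [hK]; nlinarith)
        simpa [Wt, hc1] using this
      calc Wt (-e) x * ENNReal.ofReal (t ^ m) * H z
          ≤ Wt (-e) x * ENNReal.ofReal (t ^ m) * ((c1 * Wt (-e) z) * H z) := by
            gcongr
            exact le_mul_of_one_le_left' h5
        _ = _ := by simp only [hf, ← hz]; ring
  -- first part
  have P1 : ∫⁻ x : Euc N, ∫⁻ y in B, ∫⁻ t in Set.Ioo (0 : ℝ) 1, F1 x y t ≤
      c1 * I1 * volume B * J := by
    have hin : Measurable fun q : Euc N × Euc N => ∫⁻ t in Set.Ioo (0 : ℝ) 1, F1 q.1 q.2 t :=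
      hF1m.lintegral_prod_right'
    rw [lintegral_lintegral_swap hin.aemeasurable]
    have : ∀ y : Euc N, ∫⁻ x : Euc N, ∫⁻ t in Set.Ioo (0 : ℝ) 1, F1 x y t ≤ c1 * I1 * J := by
      intro y
      rw [lintegral_lintegral_swap]
      · have : ∀ t ∈ Set.Ioo (0 : ℝ) 1, ∫⁻ x : Euc N, F1 x y t =
            c1 * ENNReal.ofReal (t ^ (e - N + m)) * J := by
          intro t ht
          simp only [F1]
          rw [lintegral_const_mul _ (by fun_prop)]
          have h7 : ∀ x : Euc N, y + t • (x - y) = (y - t • y) + t • x := fun x => by module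
          simp_rw [h7]
          rw [lintegral_affine f _ ht.1, ← hJ]
          have h8 : ENNReal.ofReal (t ^ (e - N + m)) =
              ENNReal.ofReal (t ^ (e + m)) * ENNReal.ofReal (t ^ (-(N : ℝ))) := by
            rw [← ENNReal.ofReal_mul (Real.rpow_nonneg ht.1.le _), ← Real.rpow_add ht.1]
            congr 2; ring
          rw [h8]
          ring
        rw [setLIntegral_congr_fun measurableSet_Ioo this]
        rw [lintegral_mul_const _ (by fun_prop), lintegral_const_mul _ (by fun_prop)]
      · have : Measurable fun q : Euc N × ℝ => F1 q.1 y q.2 :=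
          hF1m.comp (f := fun q : Euc N × ℝ => ((q.1, y), q.2)) (by fun_prop)
        exact this.aemeasurable
    refine (lintegral_mono this).trans ?_
    rw [setLIntegral_const]
    apply le_of_eq; ring
  have P2 : ∫⁻ x : Euc N, ∫⁻ y in B, ∫⁻ t in Set.Ioo (0 : ℝ) 1, F2 x y t ≤
      c1 * ENNReal.ofReal (2 ^ (N : ℝ)) * I2 * J := by
    have : ∀ x : Euc N, ∫⁻ y in B, ∫⁻ t in Set.Ioo (0 : ℝ) 1, F2 x y t ≤
        c1 * ENNReal.ofReal (2 ^ (N : ℝ)) * J * Wt (-(e + m + 1)) x := by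
      intro x
      have hpx := one_add_norm_pos x
      rw [lintegral_lintegral_swap]
      · have : ∀ t ∈ Set.Ioo (0 : ℝ) 1, ∫⁻ y in B, F2 x y t ≤
            (Set.Iio (1 / (2 * (1 + ‖x‖)))).indicator (fun _ => c1 * Wt (-e) x * Wt (-m) x *
              (ENNReal.ofReal (2 ^ (N : ℝ)) * J)) t := by
          intro t ht
          by_cases hmem : t ∈ Set.Iio (1 / (2 * (1 + ‖x‖)))
          · simp only [F2, Set.indicator_of_mem hmem]
            have htx : t < 1 / (2 * (1 + ‖x‖)) := hmem
            have ht2 : t ≤ (1 + ‖x‖)⁻¹ := by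
              refine htx.le.trans ?_
              rw [one_div]
              apply inv_anti₀ hpx; linarith
            have ht3 : t < 1 / 2 := by
              refine htx.trans_le ?_
              apply one_div_le_one_div_of_le (by norm_num)
              linarith [norm_nonneg x]
            refine (setLIntegral_le_lintegral _ _).trans ?_
            rw [lintegral_const_mul _ (by fun_prop)]
            have h7 : ∀ y : Euc N, y + t • (x - y) = (t • x) + (1 - t) • y := fun x => by module
            simp_rw [h7]
            rw [lintegral_affine f _ (by linarith : 0 < 1 - t), ← hJ]
            gcongr
            · unfold Wt
              rw [Real.rpow_neg hpx.le, ← Real.inv_rpow hpx.le]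
              exact ENNReal.ofReal_le_ofReal (Real.rpow_le_rpow ht.1.le ht2 hm)
            · rw [Real.rpow_neg (by linarith), ← Real.inv_rpow (by linarith)]
              apply Real.rpow_le_rpow (inv_nonneg.2 (by linarith)) _ (by positivity)
              rw [inv_le_comm₀ (by linarith) (by norm_num)]; linarith
          · simp only [F2, Set.indicator_of_notMem hmem]; simp
        refine (setLIntegral_mono' measurableSet_Ioo this).trans ?_
        rw [lintegral_indicator measurableSet_Iio, setLIntegral_const,
          Measure.restrict_apply measurableSet_Iio]
        have hvol : volume (Set.Iio (1 / (2 * (1 + ‖x‖))) ∩ Set.Ioo (0 : ℝ) 1) ≤ Wt (-1) x := by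
          refine (measure_mono (t := Set.Ioo 0 (1 / (2 * (1 + ‖x‖)))) ?_).trans ?_
          · rintro t ⟨h1, h2⟩; exact ⟨h2.1, h1⟩
          · rw [Real.volume_Ioo, Wt, Real.rpow_neg_one, sub_zero]
            apply ENNReal.ofReal_le_ofReal
            rw [one_div]
            apply inv_anti₀ hpx; linarith
        calc _ ≤ c1 * Wt (-e) x * Wt (-m) x * (ENNReal.ofReal (2 ^ (N : ℝ)) * J) * Wt (-1) x := by
              gcongr
          _ = _ := by
            rw [show -(e + m + 1) = -e + -m + -1 by ring, Wt_add, Wt_add]; ring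
      · have : Measurable fun q : Euc N × ℝ => F2 x q.1 q.2 :=
          hF2m.comp (f := fun q : Euc N × ℝ => ((x, q.1), q.2)) (by fun_prop)
        exact this.aemeasurable
    refine (lintegral_mono this).trans ?_
    rw [lintegral_const_mul _ (by fun_prop)]
    apply le_of_eq; ring
  calc _ ≤ ∫⁻ x : Euc N, ∫⁻ y in B, ∫⁻ t in Set.Ioo (0 : ℝ) 1, (F1 x y t + F2 x y t) := by
        refine lintegral_mono fun x => ?_
        refine setLIntegral_mono' measurableSet_ball fun y hy => ?_
        exact setLIntegral_mono' measurableSet_Ioo fun t ht => key x y hy t ht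
    _ = (∫⁻ x : Euc N, ∫⁻ y in B, ∫⁻ t in Set.Ioo (0 : ℝ) 1, F1 x y t) +
        ∫⁻ x : Euc N, ∫⁻ y in B, ∫⁻ t in Set.Ioo (0 : ℝ) 1, F2 x y t := by
        have a1 : ∀ x y, Measurable (F1 x y) := fun x y =>
          hF1m.comp (f := fun t : ℝ => ((x, y), t)) (by fun_prop)
        have a2 : Measurable fun q : Euc N × Euc N => ∫⁻ t in Set.Ioo (0 : ℝ) 1, F1 q.1 q.2 t :=
          hF1m.lintegral_prod_right'
        have a3 : Measurable fun x => ∫⁻ y in B, ∫⁻ t in Set.Ioo (0 : ℝ) 1, F1 x y t :=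
          a2.lintegral_prod_right'
        rw [← lintegral_add_left a3]
        congr 1; ext x
        have a4 : Measurable fun y => ∫⁻ t in Set.Ioo (0 : ℝ) 1, F1 x y t :=
          a2.comp (f := fun y => (x, y)) (by fun_prop)
        rw [← lintegral_add_left a4]
        congr 1; ext y
        rw [← lintegral_add_left (a1 x y)]
    _ ≤ _ := by rw [add_mul]; exact add_le_add P1 P2

/-- Hardy–Poincaré for `C¹` functions, in double integral form. -/
lemma hardy_smooth {N : ℕ} (s p ρ : ℝ) (hs : -1 < s) (hp : 1 ≤ p) (hρ : 0 < ρ) :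
    ∃ C : ℝ≥0∞, C ≠ ∞ ∧ ∀ u : Euc N → ℝ, ContDiff ℝ 1 u →
      ∫⁻ x : Euc N, Wt (-(s + 1) * p - N) x * ∫⁻ y in ball (0 : Euc N) ρ, ‖u x - u y‖ₑ ^ p ≤
      C * ∫⁻ z, Wt (-s * p - N) z * ‖fderiv ℝ u z‖ₑ ^ p := by
  obtain ⟨β, hβ0, hβ1, hβ⟩ : ∃ β : ℝ, 0 ≤ β ∧ β < 1 ∧ -1 < s * p + β * (p - 1) := by
    refine ⟨max 0 (1 - (s + 1) / 2), le_max_left _ _, by simp; linarith, ?_⟩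
    have : 1 - (s + 1) / 2 ≤ max 0 (1 - (s + 1) / 2) := le_max_right _ _
    nlinarith
  obtain ⟨C, hC, hcore⟩ := hardy_core (N := N) ρ (s * p + N) (β * (p - 1)) hρ
    (mul_nonneg hβ0 (by linarith)) (by linarith)
  set D := (∫⁻ t in Set.Ioo (0 : ℝ) 1, ENNReal.ofReal (t ^ (-β))) ^ (p - 1) with hD
  have hDt : D ≠ ∞ := ENNReal.rpow_ne_top_of_nonneg (by linarith)
    (lintegral_unit_rpow_lt_top (by linarith)).ne
  refine ⟨ENNReal.ofReal ((1 + ρ) ^ p) * D * C, ENNReal.mul_ne_top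
    (ENNReal.mul_ne_top ENNReal.ofReal_ne_top hDt) hC, fun u hu => ?_⟩
  have hcf := hu.continuous_fderiv one_ne_zero
  have hHm : Measurable fun z => ‖fderiv ℝ u z‖ₑ ^ p := by
    have : Measurable fun z => ‖fderiv ℝ u z‖ₑ := hcf.enorm.measurable
    fun_prop
  have h := hcore _ hHm
  have e0 : -(s * p + N) = -s * p - N := by ring
  rw [e0] at h
  rw [mul_assoc _ C]
  refine le_trans ?_ (mul_le_mul_right h _)
  rw [← lintegral_const_mul' _ _ (ENNReal.mul_ne_top ENNReal.ofReal_ne_top hDt)]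
  refine lintegral_mono fun x => ?_
  rw [← lintegral_const_mul' _ _ (Wt_ne_top _ _),
    ← lintegral_const_mul' _ _ (ENNReal.mul_ne_top ENNReal.ofReal_ne_top hDt)]
  refine setLIntegral_mono' measurableSet_ball fun y hy => ?_
  have hyn : ‖y‖ < ρ := by simpa using hy
  have hmeas : Measurable fun t : ℝ => ‖fderiv ℝ u (y + t • (x - y))‖ₑ := by
    have : Continuous fun t : ℝ => fderiv ℝ u (y + t • (x - y)) := by fun_prop
    exact this.enorm.measurable
  have h1 : ‖u x - u y‖ₑ ^ p ≤ ENNReal.ofReal ((1 + ρ) ^ p) * Wt p x * (D *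
      ∫⁻ t in Set.Ioo (0 : ℝ) 1, ENNReal.ofReal (t ^ (β * (p - 1))) *
        ‖fderiv ℝ u (y + t • (x - y))‖ₑ ^ p) := by
    refine (ENNReal.rpow_le_rpow (ftc_enorm hu x y) (by linarith)).trans ?_
    rw [ENNReal.mul_rpow_of_nonneg _ _ (by linarith)]
    refine mul_le_mul' ?_ (holder_unit hmeas hp)
    unfold Wt
    rw [← ENNReal.ofReal_mul (by positivity), ENNReal.ofReal_rpow_of_nonneg (by positivity)
      (by linarith), ← Real.mul_rpow (by positivity) (by positivity)]
    apply ENNReal.ofReal_le_ofReal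
    apply Real.rpow_le_rpow (by positivity) _ (by linarith)
    have := norm_sub_le x y
    nlinarith [norm_nonneg x]
  calc _ ≤ Wt (-(s + 1) * p - N) x * _ := mul_le_mul_right h1 _
    _ = ENNReal.ofReal ((1 + ρ) ^ p) * D * (Wt (-s * p - N) x *
      ∫⁻ t in Set.Ioo (0 : ℝ) 1, ENNReal.ofReal (t ^ (β * (p - 1))) *
        ‖fderiv ℝ u (y + t • (x - y))‖ₑ ^ p) := by
      rw [show -s * p - N = (-(s + 1) * p - N) + p by ring, Wt_add]; ring
    _ = _ := by
      rw [← lintegral_const_mul' _ _ (Wt_ne_top _ _)]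
      simp only [mul_assoc]

lemma eLpNorm_ofReal_eq {α F : Type*} [MeasurableSpace α] [NormedAddCommGroup F] (μ : Measure α)
    (f : α → F) {p : ℝ} (hp : 0 < p) :
    eLpNorm f (ENNReal.ofReal p) μ = (∫⁻ x, ‖f x‖ₑ ^ p ∂μ) ^ (1 / p) := by
  rw [eLpNorm_eq_lintegral_rpow_enorm_toReal (by simpa using hp) ENNReal.ofReal_ne_top,
    ENNReal.toReal_ofReal hp.le]

lemma holder_one {α : Type*} [MeasurableSpace α] (μ : Measure α)
    {f : α → ℝ≥0∞} (hf : AEMeasurable f μ) {p : ℝ} (hp : 1 ≤ p) :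
    ∫⁻ x, f x ∂μ ≤ (∫⁻ x, f x ^ p ∂μ) ^ (1 / p) * μ Set.univ ^ (1 - 1 / p) := by
  rcases hp.eq_or_lt with rfl | hp
  · simp
  have hc : p.HolderConjugate (p.conjExponent) := Real.HolderConjugate.conjExponent hp
  have := ENNReal.lintegral_mul_le_Lp_mul_Lq μ hc hf (aemeasurable_const (b := (1 : ℝ≥0∞)))
  have e : 1 / p.conjExponent = 1 - 1 / p := by
    have := hc.inv_add_inv_eq_one
    simp only [one_div]; linarith
  rw [e] at this
  simpa using this

lemma sup_bound_gt {N : ℕ} (hN : 1 ≤ N) {p : ℝ} (hp : 1 ≤ p) (hpN : (N : ℝ) < p) :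
    ∃ C : ℝ≥0∞, C ≠ ∞ ∧ ∀ f : Euc N → ℝ, ContDiff ℝ 1 f → f.support ⊆ ball 0 2 →
      ∀ x, ‖f x‖ₑ ≤ C * eLpNorm (fderiv ℝ f) (ENNReal.ofReal p) volume := by
  have hp0 : 0 < p := by linarith
  set e : Euc N := EuclideanSpace.single (⟨0, hN⟩ : Fin N) (5 : ℝ) with he
  have hen : ‖e‖ = 5 := by simp [he]
  set B : Set (Euc N) := ball e 1 with hB
  have hBt : volume B ≠ ∞ := measure_ball_lt_top.ne
  have hB0 : volume B ≠ 0 := (measure_ball_pos volume e one_pos).ne'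
  set I : ℝ≥0∞ := ∫⁻ t in Set.Ioo (0 : ℝ) 1, ENNReal.ofReal (t ^ (-(N : ℝ) / p)) with hI
  have hIt : I ≠ ∞ := (lintegral_unit_rpow_lt_top (by
    rw [neg_div, neg_lt_neg_iff, div_lt_one hp0]; exact hpN)).ne
  set V := volume B ^ (1 - 1 / p) with hV
  have hVt : V ≠ ∞ := ENNReal.rpow_ne_top_of_nonneg
    (by rw [sub_nonneg, div_le_one hp0]; exact hp) hBt
  refine ⟨(volume B)⁻¹ * (6 * (I * V)), ?_, fun f hf hsupp x => ?_⟩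
  · exact ENNReal.mul_ne_top (ENNReal.inv_ne_top.2 hB0) (ENNReal.mul_ne_top (by simp)
      (ENNReal.mul_ne_top hIt hVt))
  set J := eLpNorm (fderiv ℝ f) (ENNReal.ofReal p) volume with hJ
  by_cases hx : x ∈ ball (0 : Euc N) 2
  swap
  · have : f x = 0 := by
      by_contra h; exact hx (hsupp h)
    simp [this]
  have hxn : ‖x‖ < 2 := by simpa using hx
  have hcf := hf.continuous_fderiv one_ne_zero
  have hmeas : Measurable fun q : Euc N × ℝ => ‖fderiv ℝ f (x + q.2 • q.1)‖ₑ := by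
    have : Continuous fun q : Euc N × ℝ => fderiv ℝ f (x + q.2 • q.1) := by fun_prop
    exact this.enorm.measurable
  have h1 : ∀ w ∈ B, ‖f x‖ₑ ≤ 6 * ∫⁻ t in Set.Ioo (0 : ℝ) 1, ‖fderiv ℝ f (x + t • w)‖ₑ := by
    intro w hw
    have hw1 : ‖w - e‖ < 1 := by simpa [hB, dist_eq_norm] using hw
    have hw2 : ‖w‖ ≤ 6 := by
      have := norm_add_le (w - e) e; rw [sub_add_cancel] at this; linarith
    have hw3 : f (x + w) = 0 := by
      by_contra h
      have h2 : ‖x + w‖ < 2 := by simpa using hsupp h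
      have h3 : ‖e‖ ≤ ‖x + w‖ + ‖w - e‖ + ‖x‖ := by
        have : e = (x + w) - (w - e) - x := by abel
        calc ‖e‖ = ‖(x + w) - (w - e) - x‖ := by rw [← this]
          _ ≤ _ := (norm_sub_le _ _).trans (by gcongr; exact norm_sub_le _ _)
      linarith
    have := ftc_enorm hf (x + w) x
    rw [hw3, zero_sub, enorm_neg, add_sub_cancel_left] at this
    refine this.trans ?_
    gcongr
    rw [show (6 : ℝ≥0∞) = ENNReal.ofReal 6 by simp]
    exact ENNReal.ofReal_le_ofReal hw2
  have h2 : volume B * ‖f x‖ₑ ≤ 6 * (I * V) * J := by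
    calc volume B * ‖f x‖ₑ = ∫⁻ w in B, ‖f x‖ₑ := by rw [setLIntegral_const, mul_comm]
      _ ≤ ∫⁻ w in B, 6 * ∫⁻ t in Set.Ioo (0 : ℝ) 1, ‖fderiv ℝ f (x + t • w)‖ₑ :=
        setLIntegral_mono' measurableSet_ball h1
      _ = 6 * ∫⁻ w in B, ∫⁻ t in Set.Ioo (0 : ℝ) 1, ‖fderiv ℝ f (x + t • w)‖ₑ := by
        rw [lintegral_const_mul' _ _ (by simp)]
      _ = 6 * ∫⁻ t in Set.Ioo (0 : ℝ) 1, ∫⁻ w in B, ‖fderiv ℝ f (x + t • w)‖ₑ := by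
        rw [lintegral_lintegral_swap hmeas.aemeasurable]
      _ ≤ 6 * ∫⁻ t in Set.Ioo (0 : ℝ) 1, ENNReal.ofReal (t ^ (-(N : ℝ) / p)) * (V * J) := by
        gcongr 6 * ?_
        refine setLIntegral_mono' measurableSet_Ioo fun t ht => ?_
        refine (holder_one _ (hmeas.comp (f := fun w => (w, t)) (by fun_prop)).aemeasurable
          hp).trans ?_
        rw [Measure.restrict_apply_univ, ← hV]
        have h5 : (∫⁻ w in B, ‖fderiv ℝ f (x + t • w)‖ₑ ^ p) ≤
            ENNReal.ofReal (t ^ (-(N : ℝ))) * ∫⁻ z, ‖fderiv ℝ f z‖ₑ ^ p := by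
          refine (setLIntegral_le_lintegral _ _).trans ?_
          rw [lintegral_affine (fun z => ‖fderiv ℝ f z‖ₑ ^ p) x ht.1]
        calc _ ≤ (ENNReal.ofReal (t ^ (-(N : ℝ))) * ∫⁻ z, ‖fderiv ℝ f z‖ₑ ^ p) ^ (1 / p) * V := by
              refine mul_le_mul_left (ENNReal.rpow_le_rpow h5 (by positivity)) _
          _ = _ := by
            rw [ENNReal.mul_rpow_of_nonneg _ _ (by positivity), hJ, eLpNorm_ofReal_eq _ _ hp0,
              ENNReal.ofReal_rpow_of_nonneg (Real.rpow_nonneg ht.1.le _) (by positivity),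
              ← Real.rpow_mul ht.1.le, mul_one_div]
            ring
      _ = _ := by rw [lintegral_mul_const _ (by fun_prop), ← hI]; ring
  calc ‖f x‖ₑ = (volume B)⁻¹ * (volume B * ‖f x‖ₑ) := by
        rw [← mul_assoc, ENNReal.inv_mul_cancel hB0 hBt, one_mul]
    _ ≤ (volume B)⁻¹ * (6 * (I * V) * J) := by gcongr
    _ = _ := by ring

lemma sup_bound_one {p : ℝ} (hp : p = 1) :
    ∃ C : ℝ≥0∞, C ≠ ∞ ∧ ∀ f : Euc 1 → ℝ, ContDiff ℝ 1 f → f.support ⊆ ball 0 2 →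
      ∀ x, ‖f x‖ₑ ≤ C * eLpNorm (fderiv ℝ f) (ENNReal.ofReal p) volume := by
  subst hp
  refine ⟨5, by simp, fun f hf hsupp x => ?_⟩
  by_cases hx : x ∈ ball (0 : Euc 1) 2
  swap
  · have : f x = 0 := by
      by_contra h; exact hx (hsupp h)
    simp [this]
  have hxn : ‖x‖ < 2 := by simpa using hx
  set e : Euc 1 := EuclideanSpace.single (0 : Fin 1) (5 : ℝ) with he
  have hen : ‖e‖ = 5 := by simp [he]
  have hw3 : f (x + e) = 0 := by
    by_contra h
    have h2 : ‖x + e‖ < 2 := by simpa using hsupp h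
    have h3 : ‖e‖ ≤ ‖x + e‖ + ‖x‖ := by
      have : e = (x + e) - x := by abel
      calc ‖e‖ = ‖(x + e) - x‖ := by rw [← this]
        _ ≤ _ := norm_sub_le _ _
    linarith
  have h1 := ftc_enorm hf (x + e) x
  rw [hw3, zero_sub, enorm_neg, add_sub_cancel_left, hen] at h1
  refine h1.trans ?_
  rw [show ENNReal.ofReal 5 = 5 by simp]
  gcongr
  rw [eLpNorm_ofReal_eq _ _ one_pos]
  simp only [ENNReal.rpow_one, div_one]
  have hmp : MeasurePreserving (fun t : ℝ => (WithLp.toLp 2 (fun _ : Fin 1 => t) : Euc 1)) :=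
    (PiLp.volume_preserving_toLp (Fin 1)).comp
      ((volume_preserving_funUnique (Fin 1) ℝ).symm (MeasurableEquiv.funUnique (Fin 1) ℝ))
  have hcf := hf.continuous_fderiv one_ne_zero
  have hG : Measurable fun z => ‖fderiv ℝ f z‖ₑ := hcf.enorm.measurable
  calc ∫⁻ t in Set.Ioo (0 : ℝ) 1, ‖fderiv ℝ f (x + t • e)‖ₑ
      ≤ ∫⁻ t : ℝ, ‖fderiv ℝ f (x + t • e)‖ₑ := setLIntegral_le_lintegral _ _
    _ = ∫⁻ z : Euc 1, ‖fderiv ℝ f (x + (5 : ℝ) • z)‖ₑ := by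
      rw [← hmp.lintegral_comp (f := fun z => ‖fderiv ℝ f (x + (5 : ℝ) • z)‖ₑ)
        (hG.comp (by fun_prop))]
      congr 1; ext t
      have : t • e = (5 : ℝ) • (WithLp.toLp 2 (fun _ : Fin 1 => t) : Euc 1) := by
        ext i
        fin_cases i
        simp [he]; ring
      rw [this]
    _ = ENNReal.ofReal (5 ^ (-((1 : ℕ) : ℝ))) * ∫⁻ z, ‖fderiv ℝ f z‖ₑ :=
      lintegral_affine (fun z => ‖fderiv ℝ f z‖ₑ) x (by norm_num)
    _ ≤ 1 * ∫⁻ z, ‖fderiv ℝ f z‖ₑ := by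
      gcongr
      rw [ENNReal.ofReal_le_one]
      apply Real.rpow_le_one_of_one_le_of_nonpos <;> norm_num
    _ = _ := one_mul _

lemma local_sobolev {N : ℕ} (hN : 1 ≤ N) {p : ℝ} (hp : 1 ≤ p) {q : ℝ≥0∞} (hq : q ∈ Ijp N 1 p) :
    ∃ C : ℝ≥0∞, C ≠ ∞ ∧ ∀ f : Euc N → ℝ, ContDiff ℝ 1 f → f.support ⊆ ball 0 2 →
      eLpNorm f q volume ≤ C * eLpNorm (fderiv ℝ f) (ENNReal.ofReal p) volume := by
  have hp0 : 0 < p := by linarith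
  have hN0 : (0 : ℝ) < N := by exact_mod_cast hN
  have hfr : Module.finrank ℝ (Euc N) = N := by simp
  have hvt : volume (ball (0 : Euc N) 2) ≠ ∞ := measure_ball_lt_top.ne
  -- sup bound case
  have hsup : (∃ C : ℝ≥0∞, C ≠ ∞ ∧ ∀ f : Euc N → ℝ, ContDiff ℝ 1 f → f.support ⊆ ball 0 2 →
      ∀ x, ‖f x‖ₑ ≤ C * eLpNorm (fderiv ℝ f) (ENNReal.ofReal p) volume) →
      ∃ C : ℝ≥0∞, C ≠ ∞ ∧ ∀ f : Euc N → ℝ, ContDiff ℝ 1 f → f.support ⊆ ball 0 2 →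
      eLpNorm f q volume ≤ C * eLpNorm (fderiv ℝ f) (ENNReal.ofReal p) volume := by
    rintro ⟨C, hC, h⟩
    refine ⟨C * volume (ball (0 : Euc N) 2) ^ (1 / q.toReal - 1 / (⊤ : ℝ≥0∞).toReal),
      ENNReal.mul_ne_top hC (ENNReal.rpow_ne_top_of_nonneg (by simp) hvt), fun f hf hs => ?_⟩
    calc eLpNorm f q volume = eLpNorm f q (volume.restrict (ball 0 2)) := by
          rw [eLpNorm_restrict_eq_of_support_subset hs]
      _ ≤ eLpNorm f ⊤ (volume.restrict (ball 0 2)) *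
          volume (ball (0 : Euc N) 2) ^ (1 / q.toReal - 1 / (⊤ : ℝ≥0∞).toReal) := by
          have := eLpNorm_le_eLpNorm_mul_rpow_measure_univ (p := q) (q := ⊤)
            (μ := volume.restrict (ball (0 : Euc N) 2)) le_top hf.continuous.aestronglyMeasurable
          rwa [Measure.restrict_apply_univ] at this
      _ ≤ (C * eLpNorm (fderiv ℝ f) (ENNReal.ofReal p) volume) * _ := by
          gcongr
          rw [eLpNorm_exponent_top]
          exact eLpNormEssSup_le_of_ae_enorm_bound (Eventually.of_forall (h f hf hs))
      _ = _ := by ring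
  unfold Ijp at hq
  simp only [Nat.cast_one, div_one, one_mul] at hq
  split_ifs at hq with h1 h2
  · -- p = N > 1
    obtain ⟨rfl, hN1⟩ := h1
    have hN1' : (1 : ℝ) < N := by exact_mod_cast hN1
    lift q to NNReal using hq.2.ne
    have hq0 : (0 : ℝ) < q := by
      have := hq.1
      rw [← ENNReal.ofReal_coe_nnreal, ENNReal.ofReal_le_ofReal_iff q.coe_nonneg] at this
      linarith
    obtain ⟨r, hr1, hrN, hrq⟩ : ∃ r : NNReal, 1 ≤ r ∧ (r : ℝ) < N ∧
        (r : ℝ)⁻¹ - (N : ℝ)⁻¹ ≤ (q : ℝ)⁻¹ := by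
      have hpos : 0 < (N : ℝ)⁻¹ + (q : ℝ)⁻¹ := by positivity
      obtain ⟨r, hr⟩ : ∃ r : NNReal, (r : ℝ) = (min 1 ((N : ℝ)⁻¹ + (q : ℝ)⁻¹))⁻¹ :=
        ⟨Real.toNNReal _, Real.coe_toNNReal _ (by positivity)⟩
      refine ⟨r, ?_, ?_, ?_⟩
      · have h6 : (1 : ℝ) ≤ r := by
          rw [hr]
          exact (one_le_inv₀ (lt_min one_pos hpos)).2 (min_le_left _ _)
        exact_mod_cast h6
      · rw [hr, inv_lt_comm₀ (lt_min one_pos hpos) hN0]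
        refine lt_min (inv_lt_one_of_one_lt₀ hN1') ?_
        have : 0 < (q : ℝ)⁻¹ := by positivity
        linarith
      · rw [hr, inv_inv]
        have := min_le_right 1 ((N : ℝ)⁻¹ + (q : ℝ)⁻¹)
        linarith
    have hvc : volume (closedBall (0 : Euc N) 2) ≠ ∞ := measure_closedBall_lt_top.ne
    have hrN' : (r : ℝ≥0∞) ≤ ENNReal.ofReal N := by
      rw [ENNReal.ofReal, ENNReal.coe_le_coe, ← NNReal.coe_le_coe]
      simp [hrN.le]
    set v := volume (closedBall (0 : Euc N) 2) ^
      (1 / (r : ℝ≥0∞).toReal - 1 / (ENNReal.ofReal N).toReal) with hv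
    have hvt' : v ≠ ∞ := by
      refine ENNReal.rpow_ne_top_of_nonneg ?_ hvc
      rw [sub_nonneg, ENNReal.toReal_ofReal hN0.le, ENNReal.coe_toReal]
      apply one_div_le_one_div_of_le _ hrN.le
      exact lt_of_lt_of_le one_pos (by exact_mod_cast hr1)
    refine ⟨eLpNormLESNormFDerivOfLeConst ℝ (volume : Measure (Euc N)) (ball 0 2) r q * v,
      ENNReal.mul_ne_top ENNReal.coe_ne_top hvt', fun f hf hs => ?_⟩
    refine (eLpNorm_le_eLpNorm_fderiv_of_le volume hf hs hr1 (by rw [hfr]; exact_mod_cast hrN)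
      (by rw [hfr]; exact hrq) isBounded_ball).trans ?_
    rw [mul_assoc]
    gcongr
    have hs' : (fun x => ‖fderiv ℝ f x‖).support ⊆ closedBall 0 2 := by
      have h7 : (fun x => ‖fderiv ℝ f x‖).support = (fderiv ℝ f).support := by
        ext x; simp
      rw [h7]
      refine (support_fderiv_subset ℝ).trans ?_
      exact closure_minimal (hs.trans ball_subset_closedBall) isClosed_closedBall
    have := eLpNorm_le_eLpNorm_mul_rpow_measure_univ (f := fun x => ‖fderiv ℝ f x‖)
      (μ := volume.restrict (closedBall (0 : Euc N) 2)) hrN'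
      (hf.continuous_fderiv one_ne_zero).norm.aestronglyMeasurable
    rw [Measure.restrict_apply_univ, eLpNorm_restrict_eq_of_support_subset hs',
      eLpNorm_restrict_eq_of_support_subset hs', eLpNorm_norm, eLpNorm_norm] at this
    rw [mul_comm]; exact this
  · -- p < N
    have hqt : q ≠ ⊤ := ne_top_of_le_ne_top ENNReal.ofReal_ne_top hq.2
    lift q to NNReal using hqt
    lift p to NNReal using hp0.le
    have hq0 : (0 : ℝ) < q := by
      have := hq.1
      rw [ENNReal.ofReal_coe_nnreal, ENNReal.coe_le_coe] at this
      exact lt_of_lt_of_le hp0 (by exact_mod_cast this)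
    refine ⟨eLpNormLESNormFDerivOfLeConst ℝ (volume : Measure (Euc N)) (ball 0 2) p q,
      ENNReal.coe_ne_top, fun f hf hs => ?_⟩
    rw [ENNReal.ofReal_coe_nnreal]
    refine eLpNorm_le_eLpNorm_fderiv_of_le volume hf hs (by exact_mod_cast hp)
      (by rw [hfr]; exact_mod_cast h2) ?_ isBounded_ball
    rw [hfr]
    have hNp : (0 : ℝ) < N - p := by linarith
    have h3 : (q : ℝ) ≤ N * p / (N - p) := by
      have := hq.2
      rwa [← ENNReal.ofReal_coe_nnreal, ENNReal.ofReal_le_ofReal_iff (by positivity)] at this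
    have h4 := inv_anti₀ hq0 h3
    refine le_trans (le_of_eq ?_) h4
    have hpp : (p : ℝ) ≠ 0 := hp0.ne'
    push_cast
    field_simp
  · -- sup case
    apply hsup
    rcases (not_lt.1 h2).eq_or_lt with h3 | h3
    · have hN1 : N = 1 := by
        by_contra hne
        exact h1 ⟨h3.symm, by omega⟩
      subst hN1
      exact sup_bound_one (by simpa using h3.symm)
    · exact sup_bound_gt hN hp h3

lemma vol_ball_eq {N : ℕ} (z : Euc N) {c : ℝ} (hc : 0 < c) :
    Wt (-(N : ℝ)) z * volume (ball z (c * (1 + ‖z‖))) =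
      ENNReal.ofReal (c ^ N) * volume (ball (0 : Euc N) 1) := by
  have h := one_add_norm_pos z
  rw [Measure.addHaar_ball_of_pos _ _ (by positivity)]
  rw [← mul_assoc, Wt, ← ENNReal.ofReal_mul (by positivity)]
  congr 2
  rw [finrank_euclideanSpace, Fintype.card_fin, Real.rpow_neg h.le, Real.rpow_natCast, mul_pow]
  field_simp

lemma near_comp {N : ℕ} {a z : Euc N} (h : ‖z - a‖ ≤ (1 + ‖a‖) / 4) :
    1 + ‖a‖ ≤ 2 * (1 + ‖z‖) ∧ 1 + ‖z‖ ≤ 2 * (1 + ‖a‖) := by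
  have h1 := norm_sub_norm_le z a
  have h2 := norm_sub_norm_le a z
  rw [norm_sub_rev a z] at h2
  constructor <;> linarith [norm_nonneg a, norm_nonneg z]

lemma cover_lemma (N : ℕ) : ∃ C : ℝ≥0∞, C ≠ ∞ ∧ ∀ F G : Euc N → ℝ≥0∞, Measurable F → Measurable G →
    (∀ a, ∫⁻ z in ball a ((1 + ‖a‖) / 8), F z ≤ ∫⁻ z in ball a ((1 + ‖a‖) / 4), G z) →
    ∫⁻ z, F z ≤ C * ∫⁻ z, G z := by
  set ω := volume (ball (0 : Euc N) 1) with hω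
  have hω0 : ω ≠ 0 := (measure_ball_pos volume _ one_pos).ne'
  have hωt : ω ≠ ∞ := measure_ball_lt_top.ne
  set K := ENNReal.ofReal ((2 : ℝ) ^ |(-(N : ℝ))|) with hK
  have hK0 : K ≠ 0 := by
    rw [hK]; simp only [ne_eq, ENNReal.ofReal_eq_zero, not_le]; positivity
  have hKt : K ≠ ∞ := ENNReal.ofReal_ne_top
  set A := ENNReal.ofReal ((1 / 16 : ℝ) ^ N) * ω with hA
  set B := ENNReal.ofReal ((1 / 3 : ℝ) ^ N) * ω with hB
  have hA0 : A ≠ 0 := mul_ne_zero (by simp) hω0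
  have hAt : A ≠ ∞ := ENNReal.mul_ne_top ENNReal.ofReal_ne_top hωt
  have hBt : B ≠ ∞ := ENNReal.mul_ne_top ENNReal.ofReal_ne_top hωt
  refine ⟨(K / A) * (K * B), ENNReal.mul_ne_top (ENNReal.div_ne_top hKt hA0)
    (ENNReal.mul_ne_top hKt hBt), fun F G hF hG h => ?_⟩
  -- Tonelli
  have ton : ∀ (c : ℝ) (H : Euc N → ℝ≥0∞), Measurable H →
      ∫⁻ a, Wt (-(N : ℝ)) a * ∫⁻ z in ball a ((1 + ‖a‖) / c), H z =
      ∫⁻ z, H z * ∫⁻ a in {a : Euc N | ‖z - a‖ < (1 + ‖a‖) / c}, Wt (-(N : ℝ)) a := by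
    intro c H hH
    have hS : MeasurableSet {x : Euc N × Euc N | ‖x.2 - x.1‖ < (1 + ‖x.1‖) / c} :=
      (isOpen_lt (by fun_prop) (by fun_prop)).measurableSet
    have e1 : ∀ a : Euc N, Wt (-(N : ℝ)) a * ∫⁻ z in ball a ((1 + ‖a‖) / c), H z =
        ∫⁻ z, {x : Euc N × Euc N | ‖x.2 - x.1‖ < (1 + ‖x.1‖) / c}.indicator
          (fun x => Wt (-(N : ℝ)) x.1 * H x.2) (a, z) := by
      intro a
      rw [← lintegral_const_mul _ hH, ← lintegral_indicator measurableSet_ball]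
      congr 1
    have e2 : ∀ z : Euc N, H z * ∫⁻ a in {a : Euc N | ‖z - a‖ < (1 + ‖a‖) / c}, Wt (-(N : ℝ)) a =
        ∫⁻ a, {x : Euc N × Euc N | ‖x.2 - x.1‖ < (1 + ‖x.1‖) / c}.indicator
          (fun x => Wt (-(N : ℝ)) x.1 * H x.2) (a, z) := by
      intro z
      have hS' : MeasurableSet {a : Euc N | ‖z - a‖ < (1 + ‖a‖) / c} :=
        (isOpen_lt (by fun_prop) (by fun_prop)).measurableSet
      rw [← lintegral_const_mul _ (measurable_Wt _), ← lintegral_indicator hS']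
      congr 1; ext a
      simp only [Set.indicator, Set.mem_ofPred_eq, mul_comm]
    simp_rw [e1, e2]
    rw [lintegral_lintegral_swap]
    exact (Measurable.indicator (by fun_prop) hS).aemeasurable
  have low : ∀ z : Euc N, A / K ≤ ∫⁻ a in {a : Euc N | ‖z - a‖ < (1 + ‖a‖) / 8}, Wt (-(N : ℝ)) a := by
    intro z
    rw [ENNReal.div_le_iff hK0 hKt, hA, ← vol_ball_eq z (by norm_num : (0 : ℝ) < 1 / 16)]
    have hsub : ball z (1 / 16 * (1 + ‖z‖)) ⊆ {a : Euc N | ‖z - a‖ < (1 + ‖a‖) / 8} := by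
      intro a ha
      rw [mem_ball, dist_eq_norm, norm_sub_rev] at ha
      have h1 := norm_sub_norm_le z a
      simp only [Set.mem_ofPred_eq]
      linarith [norm_nonneg a, norm_nonneg z]
    rw [← setLIntegral_const, ← lintegral_mul_const _ (measurable_Wt _)]
    refine (lintegral_mono_set hsub).trans' ?_
    refine setLIntegral_mono' measurableSet_ball fun a ha => ?_
    have h8 := hsub ha
    simp only [Set.mem_ofPred_eq] at h8
    have := near_comp (a := a) (z := z) (by linarith [norm_nonneg a])
    rw [mul_comm]
    exact Wt_comp _ (by norm_num) this.2 this.1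
  have upp : ∀ z : Euc N, ∫⁻ a in {a : Euc N | ‖z - a‖ < (1 + ‖a‖) / 4}, Wt (-(N : ℝ)) a ≤ K * B := by
    intro z
    rw [hB, ← vol_ball_eq z (by norm_num : (0 : ℝ) < 1 / 3)]
    have hsub : {a : Euc N | ‖z - a‖ < (1 + ‖a‖) / 4} ⊆ ball z (1 / 3 * (1 + ‖z‖)) := by
      intro a ha
      simp only [Set.mem_ofPred_eq] at ha
      rw [mem_ball, dist_eq_norm, norm_sub_rev]
      have h1 := norm_sub_norm_le a z
      rw [norm_sub_rev] at h1
      linarith [norm_nonneg a, norm_nonneg z]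
    refine (lintegral_mono_set hsub).trans ?_
    rw [← mul_assoc, ← setLIntegral_const]
    refine setLIntegral_mono' measurableSet_ball fun a ha => ?_
    rw [mem_ball, dist_eq_norm, norm_sub_rev] at ha
    have h1 := norm_sub_norm_le z a
    have h2 := norm_sub_norm_le a z
    rw [norm_sub_rev a z] at h2
    exact Wt_comp _ (by norm_num) (by linarith [norm_nonneg a, norm_nonneg z])
      (by linarith [norm_nonneg a, norm_nonneg z])
  have m1 : (A / K) * ∫⁻ z, F z ≤ (K * B) * ∫⁻ z, G z := by
    calc (A / K) * ∫⁻ z, F z = ∫⁻ z, F z * (A / K) := by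
          rw [lintegral_mul_const _ hF, mul_comm]
      _ ≤ ∫⁻ z, F z * ∫⁻ a in {a : Euc N | ‖z - a‖ < (1 + ‖a‖) / 8}, Wt (-(N : ℝ)) a :=
          lintegral_mono fun z => mul_le_mul_right (low z) _
      _ = ∫⁻ a, Wt (-(N : ℝ)) a * ∫⁻ z in ball a ((1 + ‖a‖) / 8), F z := (ton 8 F hF).symm
      _ ≤ ∫⁻ a, Wt (-(N : ℝ)) a * ∫⁻ z in ball a ((1 + ‖a‖) / 4), G z :=
          lintegral_mono fun a => mul_le_mul_right (h a) _
      _ = ∫⁻ z, G z * ∫⁻ a in {a : Euc N | ‖z - a‖ < (1 + ‖a‖) / 4}, Wt (-(N : ℝ)) a := ton 4 G hG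
      _ ≤ ∫⁻ z, G z * (K * B) := lintegral_mono fun z => mul_le_mul_right (upp z) _
      _ = _ := by rw [lintegral_mul_const _ hG, mul_comm]
  calc ∫⁻ z, F z = (K / A) * ((A / K) * ∫⁻ z, F z) := by
        rw [← mul_assoc, ENNReal.div_eq_inv_mul, ENNReal.div_eq_inv_mul,
          show A⁻¹ * K * (K⁻¹ * A) = (A⁻¹ * A) * (K * K⁻¹) by ring,
          ENNReal.inv_mul_cancel hA0 hAt, ENNReal.mul_inv_cancel hK0 hKt, one_mul, one_mul]
    _ ≤ (K / A) * ((K * B) * ∫⁻ z, G z) := by gcongr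
    _ = _ := by ring

/-- local energy density -/
def Phi {N : ℕ} (s p : ℝ) (v : Euc N → ℝ) (z : Euc N) : ℝ≥0∞ :=
  Wt (-(s + 1) * p - N) z * ‖v z‖ₑ ^ p + Wt (-s * p - N) z * ‖fderiv ℝ v z‖ₑ ^ p

lemma measurable_Phi {N : ℕ} (s p : ℝ) {v : Euc N → ℝ} (hv : ContDiff ℝ 1 v) :
    Measurable (Phi s p v) := by
  have h1 := (hv.continuous_fderiv one_ne_zero).enorm.measurable
  have h2 := hv.continuous.enorm.measurable
  unfold Phi
  exact ((measurable_Wt _).mul (h2.pow_const _)).add ((measurable_Wt _).mul (h1.pow_const _))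

lemma Wt_mul_cancel {N : ℕ} (a : ℝ) (z : Euc N) (c : ℝ≥0∞) : Wt (-a) z * (Wt a z * c) = c := by
  rw [← mul_assoc, ← Wt_add, neg_add_cancel, Wt_zero, one_mul]

lemma local_est {N : ℕ} (hN : 1 ≤ N) (s : ℝ) {p : ℝ} (hp : 1 ≤ p) {q : ℝ≥0∞} (hq : q ∈ Ijp N 1 p) :
    ∃ C : ℝ≥0∞, C ≠ ∞ ∧ ∀ v : Euc N → ℝ, ContDiff ℝ 1 v → ∀ a : Euc N,
      ∃ f : Euc N → ℝ, Continuous f ∧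
        (∀ x ∈ ball (0 : Euc N) 1, f x = v (a + ((1 + ‖a‖) / 8) • x)) ∧
        eLpNorm f q volume ≤ C * Wt (s + 1) a *
          (∫⁻ z in ball a ((1 + ‖a‖) / 4), Phi s p v z) ^ (1 / p) := by
  have hp0 : 0 < p := by linarith
  obtain ⟨C, hC, hLS⟩ := local_sobolev hN hp hq
  let η : ContDiffBump (0 : Euc N) := ⟨1, 2, one_pos, one_lt_two⟩
  have hη : ContDiff ℝ 1 η := η.contDiff
  obtain ⟨M, hM⟩ : ∃ M : ℝ, ∀ x, ‖fderiv ℝ η x‖ ≤ M :=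
    (hη.continuous_fderiv one_ne_zero).bounded_above_of_compact_support
      (η.hasCompactSupport.fderiv ℝ)
  set m : ℝ≥0∞ := ENNReal.ofReal M with hm
  have hm' : ∀ x, ‖fderiv ℝ η x‖ₑ ≤ m := fun x => by
    rw [← ofReal_norm]; exact ENNReal.ofReal_le_ofReal (hM x)
  set K1 := ENNReal.ofReal ((2 : ℝ) ^ |(s + 1) * p + N|) with hK1
  set K2 := ENNReal.ofReal ((2 : ℝ) ^ |s * p + N|) with hK2
  set D : ℝ≥0∞ := 2 ^ (p - 1) * (m ^ p * K1 + K2) with hD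
  have hDt : D ≠ ∞ := ENNReal.mul_ne_top (ENNReal.rpow_ne_top_of_nonneg (by linarith) (by simp))
    (ENNReal.add_ne_top.2 ⟨ENNReal.mul_ne_top (ENNReal.rpow_ne_top_of_nonneg hp0.le
      ENNReal.ofReal_ne_top) ENNReal.ofReal_ne_top, ENNReal.ofReal_ne_top⟩)
  set E : ℝ≥0∞ := (D * ENNReal.ofReal (8 ^ (N : ℝ))) ^ (1 / p) with hE
  have hEt : E ≠ ∞ := ENNReal.rpow_ne_top_of_nonneg (by positivity)
    (ENNReal.mul_ne_top hDt ENNReal.ofReal_ne_top)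
  refine ⟨C * E, ENNReal.mul_ne_top hC hEt, fun v hv a => ?_⟩
  set r := (1 + ‖a‖) / 8 with hr
  have hr0 : 0 < r := by have := one_add_norm_pos a; positivity
  have hr2 : (1 + ‖a‖) / 4 = 2 * r := by rw [hr]; ring
  set f : Euc N → ℝ := fun x => η x * v (a + r • x) with hf
  have hg : ContDiff ℝ 1 fun x => v (a + r • x) := hv.comp (by fun_prop)
  have hfc : ContDiff ℝ 1 f := hη.mul hg
  have hsupp : f.support ⊆ ball 0 2 := by
    intro x hx
    have : η x ≠ 0 := left_ne_zero_of_mul hx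
    have : x ∈ Function.support η := this
    rwa [η.support_eq] at this
  refine ⟨f, hfc.continuous, fun x hx => ?_, ?_⟩
  · have : η x = 1 := η.one_of_mem_closedBall (ball_subset_closedBall hx)
    simp [hf, this]
  refine (hLS f hfc hsupp).trans ?_
  rw [mul_assoc C, mul_assoc C]
  gcongr
  rw [eLpNorm_ofReal_eq _ _ hp0]
  have key : ∀ x, ‖fderiv ℝ f x‖ₑ ^ p ≤ D * Wt ((s + 1) * p + N) a *
      (ball a (2 * r)).indicator (Phi s p v) (a + r • x) := by
    intro x
    by_cases hx2 : x ∈ ball (0 : Euc N) 2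
    swap
    · -- on the sphere, f and its derivative vanish: f is zero with minimal abs
      have h0 : fderiv ℝ f x = 0 := by
        have hd1 : fderiv ℝ η x = 0 := by
          apply IsLocalMin.fderiv_eq_zero
          refine Eventually.of_forall fun y => ?_
          have h3 : η x = 0 := by
            by_contra h
            have : x ∈ Function.support η := h
            rw [η.support_eq] at this; exact hx2 this
          rw [h3]; exact η.nonneg
        have h3 : η x = 0 := by
          by_contra h
          have : x ∈ Function.support η := h
          rw [η.support_eq] at this; exact hx2 this
        rw [hf, fderiv_fun_mul (hη.differentiable one_ne_zero x) (hg.differentiable one_ne_zero x), hd1, h3]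
        simp
      have h00 : ‖fderiv ℝ f x‖ₑ = 0 := by rw [← ofReal_norm, h0]; simp
      rw [h00, ENNReal.zero_rpow_of_pos hp0]
      exact zero_le
    have hxn : ‖x‖ < 2 := by simpa using hx2
    set z := a + r • x with hz
    have hza : ‖z - a‖ < 2 * r := by
      rw [hz, add_sub_cancel_left, norm_smul, Real.norm_of_nonneg hr0.le]
      nlinarith
    have hzb : z ∈ ball a (2 * r) := by rwa [mem_ball, dist_eq_norm]
    obtain ⟨c1, c2⟩ := near_comp (a := a) (z := z) (by rw [hr2]; exact hza.le)
    rw [Set.indicator_of_mem hzb]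
    have hdg : fderiv ℝ (fun x => v (a + r • x)) x = r • fderiv ℝ v z := by
      have h1 : HasFDerivAt (fun x : Euc N => a + r • x) (r • ContinuousLinearMap.id ℝ (Euc N)) x :=
        ((hasFDerivAt_id x).const_smul r).const_add a
      have h2 := ((hv.differentiable one_ne_zero z).hasFDerivAt).comp x h1
      rw [show (fun x => v (a + r • x)) = v ∘ (fun x : Euc N => a + r • x) from rfl, h2.fderiv]
      ext y; simp
    have h1 : ‖fderiv ℝ f x‖ₑ ≤ m * ‖v z‖ₑ + ENNReal.ofReal r * ‖fderiv ℝ v z‖ₑ := by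
      have h2 : ‖fderiv ℝ f x‖ ≤ M * ‖v z‖ + r * ‖fderiv ℝ v z‖ := by
        rw [hf, fderiv_fun_mul (hη.differentiable one_ne_zero x)
          (hg.differentiable one_ne_zero x), hdg]
        refine (norm_add_le _ _).trans ?_
        rw [add_comm, norm_smul, norm_smul, norm_smul, Real.norm_of_nonneg hr0.le]
        gcongr ?_ + ?_
        · rw [mul_comm]; gcongr; exact hM x
        · have h1 : ‖η x‖ ≤ 1 := by
            rw [Real.norm_of_nonneg η.nonneg]
            exact η.le_one
          exact mul_le_of_le_one_left (by positivity) h1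
      have hM0 : 0 ≤ M := (norm_nonneg _).trans (hM 0)
      rw [← ofReal_norm, ← ofReal_norm, ← ofReal_norm, hm, ← ENNReal.ofReal_mul hM0,
        ← ENNReal.ofReal_mul hr0.le, ← ENNReal.ofReal_add (by positivity) (by positivity)]
      exact ENNReal.ofReal_le_ofReal h2
    have hrp : ENNReal.ofReal r ≤ Wt 1 a := by
      rw [Wt, Real.rpow_one]
      apply ENNReal.ofReal_le_ofReal
      rw [hr]; linarith [norm_nonneg a]
    have a1 : ‖v z‖ₑ ^ p ≤ K1 * Wt ((s + 1) * p + N) a * Phi s p v z := by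
      calc ‖v z‖ₑ ^ p = Wt (-(-(s + 1) * p - N)) z * (Wt (-(s + 1) * p - N) z * ‖v z‖ₑ ^ p) :=
            (Wt_mul_cancel _ _ _).symm
        _ ≤ (K1 * Wt ((s + 1) * p + N) a) * Phi s p v z := by
            gcongr
            · rw [show -(-(s + 1) * p - (N : ℝ)) = (s + 1) * p + N by ring]
              exact Wt_comp _ (by norm_num) c2 c1
            · exact le_self_add
    have a2 : ENNReal.ofReal r ^ p * ‖fderiv ℝ v z‖ₑ ^ p ≤
        K2 * Wt ((s + 1) * p + N) a * Phi s p v z := by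
      calc ENNReal.ofReal r ^ p * ‖fderiv ℝ v z‖ₑ ^ p
          ≤ Wt 1 a ^ p * (Wt (-(-s * p - N)) z * (Wt (-s * p - N) z * ‖fderiv ℝ v z‖ₑ ^ p)) := by
            rw [Wt_mul_cancel]; gcongr
        _ ≤ Wt p a * ((K2 * Wt (s * p + N) a) * Phi s p v z) := by
            rw [Wt_rpow _ hp0.le, one_mul]
            gcongr
            · rw [show -(-s * p - (N : ℝ)) = s * p + N by ring]
              exact Wt_comp _ (by norm_num) c2 c1
            · exact le_add_self
        _ = K2 * (Wt p a * Wt (s * p + N) a) * Phi s p v z := by ring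
        _ = _ := by rw [← Wt_add]; congr 3; ring
    calc ‖fderiv ℝ f x‖ₑ ^ p ≤ (m * ‖v z‖ₑ + ENNReal.ofReal r * ‖fderiv ℝ v z‖ₑ) ^ p := by gcongr
      _ ≤ 2 ^ (p - 1) * ((m * ‖v z‖ₑ) ^ p + (ENNReal.ofReal r * ‖fderiv ℝ v z‖ₑ) ^ p) :=
          ENNReal.rpow_add_le_mul_rpow_add_rpow _ _ hp
      _ = 2 ^ (p - 1) * (m ^ p * ‖v z‖ₑ ^ p + ENNReal.ofReal r ^ p * ‖fderiv ℝ v z‖ₑ ^ p) := by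
          rw [ENNReal.mul_rpow_of_nonneg _ _ hp0.le, ENNReal.mul_rpow_of_nonneg _ _ hp0.le]
      _ ≤ 2 ^ (p - 1) * (m ^ p * (K1 * Wt ((s + 1) * p + N) a * Phi s p v z) +
            K2 * Wt ((s + 1) * p + N) a * Phi s p v z) := by gcongr
      _ = _ := by rw [hD]; ring
  have hmP := measurable_Phi s p hv
  calc (∫⁻ x, ‖fderiv ℝ f x‖ₑ ^ p) ^ (1 / p)
      ≤ (∫⁻ x, D * Wt ((s + 1) * p + N) a *
          (ball a (2 * r)).indicator (Phi s p v) (a + r • x)) ^ (1 / p) := by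
        gcongr with x
        exact key x
    _ = (D * Wt ((s + 1) * p + N) a * (ENNReal.ofReal (r ^ (-(N : ℝ))) *
          ∫⁻ z in ball a (2 * r), Phi s p v z)) ^ (1 / p) := by
        rw [lintegral_const_mul' _ _ (ENNReal.mul_ne_top hDt (Wt_ne_top _ _)),
          lintegral_affine _ a hr0, lintegral_indicator measurableSet_ball]
    _ = (D * ENNReal.ofReal (8 ^ (N : ℝ)) * Wt ((s + 1) * p) a *
          ∫⁻ z in ball a (2 * r), Phi s p v z) ^ (1 / p) := by
        have : ENNReal.ofReal (r ^ (-(N : ℝ))) = ENNReal.ofReal (8 ^ (N : ℝ)) * Wt (-(N : ℝ)) a := by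
          rw [Wt, ← ENNReal.ofReal_mul (by positivity), hr,
            Real.div_rpow (one_add_norm_pos a).le (by norm_num), Real.rpow_neg (by norm_num : (0:ℝ) ≤ 8)]
          congr 1
          field_simp
        have h9 : Wt ((s + 1) * p) a = Wt ((s + 1) * p + N) a * Wt (-(N : ℝ)) a := by
          rw [← Wt_add]; congr 1; ring
        rw [this, h9]
        congr 1
        ring
    _ = E * (Wt (s + 1) a * (∫⁻ z in ball a (2 * r), Phi s p v z) ^ (1 / p)) := by
        rw [ENNReal.mul_rpow_of_nonneg _ _ (by positivity),
          ENNReal.mul_rpow_of_nonneg _ _ (by positivity), ← hE, Wt_rpow _ (by positivity), mul_assoc]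
        rw [mul_one_div, mul_div_cancel_right₀ _ hp0.ne']
    _ = _ := by rw [hr2, mul_assoc]

lemma Ijp_ge {N : ℕ} {p : ℝ} {q : ℝ≥0∞} (hq : q ∈ Ijp N 1 p) : ENNReal.ofReal p ≤ q := by
  unfold Ijp at hq
  split_ifs at hq <;> exact hq.1

lemma enorm_le_of_cont {N : ℕ} {f : Euc N → ℝ} (hf : Continuous f) (x : Euc N) :
    ‖f x‖ₑ ≤ eLpNorm f ⊤ volume := by
  by_contra h
  push Not at h
  have ho : IsOpen {y | eLpNorm f ⊤ volume < ‖f y‖ₑ} :=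
    isOpen_lt continuous_const hf.enorm
  have h0 : volume {y | eLpNorm f ⊤ volume < ‖f y‖ₑ} = 0 := by
    have := enorm_ae_le_eLpNormEssSup f volume
    rw [ae_iff] at this
    simpa [eLpNorm_exponent_top] using this
  rw [ho.measure_eq_zero_iff (μ := (volume : Measure (Euc N)))] at h0
  have : x ∈ {y | eLpNorm f ⊤ volume < ‖f y‖ₑ} := h
  rw [h0] at this
  exact this

lemma enorm_wt_mul {N : ℕ} (s : ℝ) (q : ℝ≥0∞) (x : Euc N) (y : ℝ) :
    ‖wt N s q x * y‖ₑ = Wt (-s - (N : ℝ) / q.toReal) x * ‖y‖ₑ := by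
  rw [enorm_mul, ← ofReal_norm (wt N s q x), Real.norm_of_nonneg]
  · rfl
  · unfold wt; have := one_add_norm_pos x; positivity

lemma smooth_sobolev {N : ℕ} (hN : 1 ≤ N) (s : ℝ) {p : ℝ} (hp : 1 ≤ p) {q : ℝ≥0∞}
    (hq : q ∈ Ijp N 1 p) :
    ∃ C : ℝ≥0∞, C ≠ ∞ ∧ ∀ v : Euc N → ℝ, ContDiff ℝ 1 v →
      eLpNorm (fun x => wt N (s + 1) q x * v x) q volume ≤
        C * (∫⁻ z, Phi s p v z) ^ (1 / p) := by
  have hp0 : 0 < p := by linarith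
  obtain ⟨C, hC, hL⟩ := local_est hN s hp hq
  by_cases hqt : q = ⊤
  · subst hqt
    refine ⟨C, hC, fun v hv => ?_⟩
    rw [eLpNorm_exponent_top]
    refine eLpNormEssSup_le_of_ae_enorm_bound (Eventually.of_forall fun a => ?_)
    obtain ⟨f, hf, hfv, hfb⟩ := hL v hv a
    have h1 := (enorm_le_of_cont hf 0).trans hfb
    rw [hfv 0 (by simp), smul_zero, add_zero] at h1
    rw [enorm_wt_mul]
    simp only [ENNReal.toReal_top, _root_.div_zero, _root_.sub_zero]
    calc Wt (-(s + 1)) a * ‖v a‖ₑ ≤ Wt (-(s + 1)) a * (C * Wt (s + 1) a *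
          (∫⁻ z in ball a ((1 + ‖a‖) / 4), Phi s p v z) ^ (1 / p)) := by gcongr
      _ = C * (Wt (-(s + 1)) a * (Wt (s + 1) a *
          (∫⁻ z in ball a ((1 + ‖a‖) / 4), Phi s p v z) ^ (1 / p))) := by ring
      _ ≤ _ := by
        rw [Wt_mul_cancel]
        exact mul_le_mul_right (ENNReal.rpow_le_rpow (setLIntegral_le_lintegral _ _)
          (by positivity)) _
  · obtain ⟨Q, hQ⟩ : ∃ Q : ℝ, Q = q.toReal := ⟨_, rfl⟩
    have hqQ : q = ENNReal.ofReal Q := by rw [hQ, ENNReal.ofReal_toReal hqt]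
    have hpQ : p ≤ Q := by
      have := Ijp_ge hq
      rw [hQ]; exact (ENNReal.ofReal_le_iff_le_toReal hqt).1 this
    have hQ0 : 0 < Q := by linarith
    obtain ⟨A, hA, hcov⟩ := cover_lemma N
    set K := ENNReal.ofReal ((2 : ℝ) ^ |-(s + 1) * Q - N|) with hK
    set D : ℝ≥0∞ := K * (ENNReal.ofReal ((8⁻¹ : ℝ) ^ (N : ℝ)) * C ^ Q) with hD
    have hDt : D ≠ ∞ := ENNReal.mul_ne_top ENNReal.ofReal_ne_top
      (ENNReal.mul_ne_top ENNReal.ofReal_ne_top (ENNReal.rpow_ne_top_of_nonneg hQ0.le hC))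
    refine ⟨(A * D) ^ (1 / Q) + 1, ENNReal.add_ne_top.2 ⟨ENNReal.rpow_ne_top_of_nonneg (by positivity)
      (ENNReal.mul_ne_top hA hDt), by simp⟩, fun v hv => ?_⟩
    set b := ∫⁻ z, Phi s p v z with hb
    by_cases hbt : b = ∞
    · rw [hbt, ENNReal.top_rpow_of_pos (by positivity), ENNReal.mul_top (by simp)]
      exact le_top
    have hmP := measurable_Phi s p hv
    have hF : Measurable fun z => Wt (-(s + 1) * Q - N) z * ‖v z‖ₑ ^ Q :=
      (measurable_Wt _).mul (hv.continuous.enorm.measurable.pow_const _)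
    have step : ∀ a : Euc N, ∫⁻ z in ball a ((1 + ‖a‖) / 8), Wt (-(s + 1) * Q - N) z * ‖v z‖ₑ ^ Q ≤
        ∫⁻ z in ball a ((1 + ‖a‖) / 4), D * b ^ (Q / p - 1) * Phi s p v z := by
      intro a
      obtain ⟨f, hf, hfv, hfb⟩ := hL v hv a
      set r := (1 + ‖a‖) / 8 with hr
      have hr0 : 0 < r := by have := one_add_norm_pos a; positivity
      set c := ∫⁻ z in ball a ((1 + ‖a‖) / 4), Phi s p v z with hc
      have hcb : c ≤ b := setLIntegral_le_lintegral _ _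
      rw [hqQ, eLpNorm_ofReal_eq _ _ hQ0] at hfb
      have h1 : ∫⁻ x, ‖f x‖ₑ ^ Q ≤ C ^ Q * Wt ((s + 1) * Q) a * c ^ (Q / p) := by
        have := ENNReal.rpow_le_rpow hfb hQ0.le
        rw [← ENNReal.rpow_mul, one_div_mul_cancel hQ0.ne', ENNReal.rpow_one,
          ENNReal.mul_rpow_of_nonneg _ _ hQ0.le, ENNReal.mul_rpow_of_nonneg _ _ hQ0.le,
          Wt_rpow _ hQ0.le, ← ENNReal.rpow_mul] at this
        rwa [one_div_mul_eq_div] at this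
      have h2 : ENNReal.ofReal (r ^ (-(N : ℝ))) * ∫⁻ z in ball a r, ‖v z‖ₑ ^ Q ≤
          ∫⁻ x, ‖f x‖ₑ ^ Q := by
        rw [← lintegral_indicator measurableSet_ball, ← lintegral_affine _ a hr0]
        refine lintegral_mono fun x => ?_
        by_cases hx : x ∈ ball (0 : Euc N) 1
        · have hx' := hx
          rw [hfv x hx]
          exact Set.indicator_le_self' (fun _ _ => zero_le) _
        · rw [Set.indicator_of_notMem]
          · exact zero_le
          · intro h
            apply hx
            rw [mem_ball, dist_eq_norm, add_sub_cancel_left, norm_smul,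
              Real.norm_of_nonneg hr0.le] at h
            rw [mem_ball, dist_zero_right]
            nlinarith
      have h3 : ∫⁻ z in ball a r, ‖v z‖ₑ ^ Q ≤
          ENNReal.ofReal (r ^ (N : ℝ)) * (C ^ Q * Wt ((s + 1) * Q) a * c ^ (Q / p)) := by
        have := mul_le_mul_right (h2.trans h1) (ENNReal.ofReal (r ^ (N : ℝ)))
        rwa [← mul_assoc, ← ENNReal.ofReal_mul (by positivity), ← Real.rpow_add hr0, add_neg_cancel,
          Real.rpow_zero, ENNReal.ofReal_one, one_mul] at this
      have h4 : ENNReal.ofReal (r ^ (N : ℝ)) = ENNReal.ofReal ((8⁻¹ : ℝ) ^ (N : ℝ)) * Wt N a := by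
        have := one_add_norm_pos a
        rw [Wt, ← ENNReal.ofReal_mul (by positivity), hr, div_eq_inv_mul,
          Real.mul_rpow (by norm_num) this.le]
      calc ∫⁻ z in ball a r, Wt (-(s + 1) * Q - N) z * ‖v z‖ₑ ^ Q
          ≤ ∫⁻ z in ball a r, (K * Wt (-(s + 1) * Q - N) a) * ‖v z‖ₑ ^ Q := by
            refine setLIntegral_mono' measurableSet_ball fun z hz => ?_
            rw [mem_ball, dist_eq_norm] at hz
            obtain ⟨c1, c2⟩ := near_comp (a := a) (z := z) (by linarith)
            gcongr
            exact Wt_comp _ (by norm_num) c2 c1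
        _ = (K * Wt (-(s + 1) * Q - N) a) * ∫⁻ z in ball a r, ‖v z‖ₑ ^ Q := by
            rw [lintegral_const_mul' _ _ (ENNReal.mul_ne_top ENNReal.ofReal_ne_top (Wt_ne_top _ _))]
        _ ≤ (K * Wt (-(s + 1) * Q - N) a) * (ENNReal.ofReal ((8⁻¹ : ℝ) ^ (N : ℝ)) * Wt N a *
              (C ^ Q * Wt ((s + 1) * Q) a * c ^ (Q / p))) := by
            rw [← h4]; gcongr
        _ = D * c ^ (Q / p) * (Wt (-(s + 1) * Q - N) a * (Wt N a * Wt ((s + 1) * Q) a)) := by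
            rw [hD]; ring
        _ = D * c ^ (Q / p) := by
            rw [← Wt_add, ← Wt_add, show -(s + 1) * Q - N + (N + (s + 1) * Q) = 0 by ring, Wt_zero,
              mul_one]
        _ = D * (c ^ (Q / p - 1) * c) := by
            congr 1
            conv_rhs => rw [← ENNReal.rpow_one c, ← ENNReal.rpow_mul, one_mul]
            rw [← ENNReal.rpow_add_of_nonneg _ _ (by rw [sub_nonneg, one_le_div hp0]; exact hpQ) zero_le_one,
              sub_add_cancel]
        _ ≤ D * (b ^ (Q / p - 1) * c) := by
            gcongr
            rw [sub_nonneg, one_le_div hp0]; exact hpQ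
        _ = _ := by
            rw [lintegral_const_mul _ hmP]; ring
    have tot := hcov _ _ hF (hmP.const_mul _) step
    rw [lintegral_const_mul _ hmP, ← hb] at tot
    have tot' : ∫⁻ z, Wt (-(s + 1) * Q - N) z * ‖v z‖ₑ ^ Q ≤ A * D * b ^ (Q / p) := by
      refine tot.trans (le_of_eq ?_)
      have : b ^ (Q / p) = b ^ (Q / p - 1) * b := by
        conv_rhs => rw [← ENNReal.rpow_one b, ← ENNReal.rpow_mul, one_mul]
        rw [← ENNReal.rpow_add_of_nonneg _ _ (by rw [sub_nonneg, one_le_div hp0]; exact hpQ) zero_le_one,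
          sub_add_cancel]
      rw [this]; ring
    have e : eLpNorm (fun x => wt N (s + 1) q x * v x) q volume =
        (∫⁻ z, Wt (-(s + 1) * Q - N) z * ‖v z‖ₑ ^ Q) ^ (1 / Q) := by
      rw [hqQ, eLpNorm_ofReal_eq _ _ hQ0]
      congr 2; ext x
      rw [enorm_wt_mul, ENNReal.toReal_ofReal hQ0.le, ENNReal.mul_rpow_of_nonneg _ _ hQ0.le,
        Wt_rpow _ hQ0.le]
      congr 2
      field_simp
    rw [e]
    calc _ ≤ (A * D * b ^ (Q / p)) ^ (1 / Q) := by gcongr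
      _ = (A * D) ^ (1 / Q) * b ^ (1 / p) := by
        rw [ENNReal.mul_rpow_of_nonneg _ _ (by positivity), ← ENNReal.rpow_mul]
        congr 2
        field_simp
      _ ≤ _ := by gcongr; exact le_self_add

/-- mollifier bump -/
def mbump (N n : ℕ) : ContDiffBump (0 : Euc N) :=
  ⟨1 / (2 * ((n : ℝ) + 1)), 1 / ((n : ℝ) + 1), by positivity, by
    apply one_div_lt_one_div_of_lt (by positivity)
    have : (0 : ℝ) ≤ n := n.cast_nonneg
    linarith⟩

/-- mollifier kernel -/
def mker (N n : ℕ) : Euc N → ℝ := (mbump N n).normed volume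

lemma mker_contDiff (N n : ℕ) : ContDiff ℝ (⊤ : ℕ∞) (mker N n) := (mbump N n).contDiff_normed
lemma mker_compact (N n : ℕ) : HasCompactSupport (mker N n) := (mbump N n).hasCompactSupport_normed
lemma mker_nonneg (N n : ℕ) (x : Euc N) : 0 ≤ mker N n x := (mbump N n).nonneg_normed x
lemma mker_integral (N n : ℕ) : ∫ x, mker N n x = 1 := (mbump N n).integral_normed
lemma mker_continuous (N n : ℕ) : Continuous (mker N n) := (mker_contDiff N n).continuous
lemma mker_zero {N n : ℕ} {x : Euc N} (hx : 1 < ‖x‖) : mker N n x = 0 := by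
  by_contra h
  have : x ∈ Function.support (mker N n) := h
  rw [mker, (mbump N n).support_normed_eq] at this
  have h2 : ‖x‖ < 1 / ((n : ℝ) + 1) := by simpa [mbump] using this
  have h3 : 1 / ((n : ℝ) + 1) ≤ 1 := by
    rw [div_le_one (by positivity)]
    have : (0 : ℝ) ≤ n := n.cast_nonneg
    linarith
  linarith

/-- mollification -/
def moll {N : ℕ} (n : ℕ) (u : Euc N → ℝ) : Euc N → ℝ :=
  convolution u (mker N n) (ContinuousLinearMap.mul ℝ ℝ) volume

lemma moll_apply {N : ℕ} (n : ℕ) (u : Euc N → ℝ) (x : Euc N) :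
    moll n u x = ∫ t, u t * mker N n (x - t) := rfl

lemma moll_apply2 {N : ℕ} (n : ℕ) (u : Euc N → ℝ) (x : Euc N) :
    moll n u x = ∫ t, mker N n t * u (x - t) := by
  rw [moll_apply, ← integral_sub_left_eq_self _ _ x]
  congr 1; ext t
  rw [_root_.sub_sub_cancel, mul_comm]

lemma moll_tendsto {N : ℕ} {u : Euc N → ℝ} (hu : LocallyIntegrable u volume) :
    ∀ᵐ x, Tendsto (fun n => moll n u x) atTop (𝓝 (u x)) := by
  have := ContDiffBump.ae_convolution_tendsto_right_of_locallyIntegrable (μ := (volume : Measure (Euc N)))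
    (φ := fun n : ℕ => mbump N n) (l := atTop) (K := 2) (g := u)
    (tendsto_one_div_add_atTop_nhds_zero_nat) (Eventually.of_forall fun n => by
      simp only [mbump]; apply le_of_eq; field_simp) hu
  filter_upwards [this] with x hx
  refine hx.congr fun n => ?_
  rw [moll_apply2]; rfl

lemma moll_contDiff {N : ℕ} (n : ℕ) {u : Euc N → ℝ} (hu : LocallyIntegrable u volume) :
    ContDiff ℝ 1 (moll n u) :=
  HasCompactSupport.contDiff_convolution_right (n := 1) _ (mker_compact N n) hu
    ((mker_contDiff N n).of_le (by exact_mod_cast le_top))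

lemma moll_fderiv {N : ℕ} (n : ℕ) {u g : Euc N → ℝ} {i : Fin N} (h : IsWeakPartialDeriv i u g)
    (x : Euc N) : fderiv ℝ (moll n u) x (EuclideanSpace.single i 1) = moll n g x := by
  have hk1 : ContDiff ℝ 1 (mker N n) := (mker_contDiff N n).of_le (by exact_mod_cast le_top)
  have h1 := HasCompactSupport.hasFDerivAt_convolution_right (ContinuousLinearMap.mul ℝ ℝ)
    (mker_compact N n) h.1 hk1 x
  have h2 : fderiv ℝ (moll n u) x = _ := h1.fderiv
  rw [h2, convolution_precompR_apply _ h.1 ((mker_compact N n).fderiv ℝ)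
    (hk1.continuous_fderiv one_ne_zero)]
  have ht := h.2.2 (fun t => mker N n (x - t)) ((mker_contDiff N n).comp (by fun_prop))
    ((mker_compact N n).comp_homeomorph (Homeomorph.subLeft x))
  simp only [pderivList, List.length_singleton, pow_one] at ht
  have hd : ∀ t, fderiv ℝ (fun t => mker N n (x - t)) t (EuclideanSpace.single i 1) =
      - fderiv ℝ (mker N n) (x - t) (EuclideanSpace.single i 1) := by
    intro t
    have e1 : HasFDerivAt (fun t : Euc N => x - t) (-ContinuousLinearMap.id ℝ (Euc N)) t :=
      (hasFDerivAt_id t).const_sub x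
    have e2 := ((hk1.differentiable one_ne_zero (x - t)).hasFDerivAt).comp t e1
    rw [show (fun t => mker N n (x - t)) = mker N n ∘ (fun t => x - t) from rfl, e2.fderiv]
    simp
  simp_rw [hd, mul_neg, integral_neg] at ht
  rw [moll_apply, convolution_def]
  simp only [ContinuousLinearMap.mul_apply']
  linarith

lemma moll_enorm_le {N : ℕ} (n : ℕ) (u : Euc N → ℝ) (x : Euc N) :
    ‖moll n u x‖ₑ ≤ ∫⁻ t, ENNReal.ofReal (mker N n t) * ‖u (x - t)‖ₑ := by
  rw [moll_apply2]
  refine (enorm_integral_le_lintegral_enorm _).trans (le_of_eq ?_)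
  congr 1; ext t
  rw [enorm_mul, ← ofReal_norm (mker N n t), Real.norm_of_nonneg (mker_nonneg N n t)]

lemma moll_weight {N : ℕ} (n : ℕ) (e : ℝ) {p : ℝ} (hp : 1 ≤ p) {f : Euc N → ℝ≥0∞}
    (hf : AEMeasurable f volume) :
    ∫⁻ x, Wt e x * (∫⁻ t, ENNReal.ofReal (mker N n t) * f (x - t)) ^ p ≤
      ENNReal.ofReal (2 ^ |e|) * ∫⁻ x, Wt e x * f x ^ p := by
  -- reduction to measurable f
  wlog hm : Measurable f generalizing f with H
  · have hae := hf.ae_eq_mk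
    have := H (f := hf.mk f) hf.measurable_mk.aemeasurable hf.measurable_mk
    refine le_trans (le_of_eq ?_) (this.trans (le_of_eq ?_))
    · congr 1; ext x
      congr 2
      refine lintegral_congr_ae ?_
      have := (quasiMeasurePreserving_sub_left (volume : Measure (Euc N)) x).ae hae
      filter_upwards [this] with t ht
      rw [ht]
    · congr 1
      refine lintegral_congr_ae ?_
      filter_upwards [hae] with t ht
      rw [ht]
  have hk : Measurable fun t => ENNReal.ofReal (mker N n t) :=
    (mker_continuous N n).measurable.ennreal_ofReal
  set μ := (volume : Measure (Euc N)).withDensity (fun t => ENNReal.ofReal (mker N n t)) with hμ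
  have hk1 : ∫⁻ t, ENNReal.ofReal (mker N n t) = 1 := by
    rw [← ofReal_integral_eq_lintegral_ofReal
      ((mker_continuous N n).integrable_of_hasCompactSupport (mker_compact N n))
      (Eventually.of_forall (mker_nonneg N n)), mker_integral, ENNReal.ofReal_one]
  have : IsProbabilityMeasure μ := ⟨by
    rw [hμ, withDensity_apply _ MeasurableSet.univ, Measure.restrict_univ, hk1]⟩
  have hfx : ∀ x, Measurable fun t => f (x - t) := fun x => hm.comp (by fun_prop)
  have hj : ∀ x, (∫⁻ t, ENNReal.ofReal (mker N n t) * f (x - t)) ^ p ≤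
      ∫⁻ t, ENNReal.ofReal (mker N n t) * f (x - t) ^ p := by
    intro x
    have := jensen_prob μ (hfx x).aemeasurable hp
    rw [hμ, lintegral_withDensity_eq_lintegral_mul _ hk (hfx x),
      lintegral_withDensity_eq_lintegral_mul _ hk ((hfx x).pow_const p)] at this
    exact this
  have hM : Measurable fun z : Euc N × Euc N =>
      Wt e z.1 * (ENNReal.ofReal (mker N n z.2) * f (z.1 - z.2) ^ p) := by
    have a1 : Measurable fun z : Euc N × Euc N => f (z.1 - z.2) := hm.comp (by fun_prop)
    exact ((measurable_Wt e).comp measurable_fst).mul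
      ((hk.comp measurable_snd).mul (a1.pow_const p))
  calc ∫⁻ x, Wt e x * (∫⁻ t, ENNReal.ofReal (mker N n t) * f (x - t)) ^ p
      ≤ ∫⁻ x, Wt e x * ∫⁻ t, ENNReal.ofReal (mker N n t) * f (x - t) ^ p :=
        lintegral_mono fun x => mul_le_mul_right (hj x) _
    _ = ∫⁻ x, ∫⁻ t, Wt e x * (ENNReal.ofReal (mker N n t) * f (x - t) ^ p) := by
        congr 1; ext x
        rw [lintegral_const_mul' _ _ (Wt_ne_top _ _)]
    _ = ∫⁻ t, ∫⁻ x, Wt e x * (ENNReal.ofReal (mker N n t) * f (x - t) ^ p) :=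
        lintegral_lintegral_swap hM.aemeasurable
    _ = ∫⁻ t, ENNReal.ofReal (mker N n t) * ∫⁻ x, Wt e (x + t) * f x ^ p := by
        congr 1; ext t
        rw [← lintegral_sub_right_eq_self (fun x => Wt e (x + t) * f x ^ p) t,
          ← lintegral_const_mul' _ _ ENNReal.ofReal_ne_top]
        congr 1; ext x
        rw [sub_add_cancel]; ring
    _ ≤ ∫⁻ t, ENNReal.ofReal (mker N n t) * (ENNReal.ofReal (2 ^ |e|) * ∫⁻ x, Wt e x * f x ^ p) := by
        refine lintegral_mono fun t => ?_
        by_cases ht : 1 < ‖t‖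
        · simp [mker_zero ht]
        push Not at ht
        dsimp only
        gcongr
        rw [← lintegral_const_mul' _ _ ENNReal.ofReal_ne_top]
        refine lintegral_mono fun x => ?_
        dsimp only
        rw [← mul_assoc]
        gcongr
        have h1 := norm_add_le x t
        have h2 : ‖x‖ ≤ ‖x + t‖ + ‖t‖ := by
          have := norm_sub_le (x + t) t; rwa [add_sub_cancel_right] at this
        exact Wt_comp _ (by norm_num) (by linarith [norm_nonneg x])
          (by linarith [norm_nonneg (x + t)])
    _ = _ := by
        rw [lintegral_mul_const _ hk, hk1, one_mul]

lemma norm_clm_le_sum {N : ℕ} (L : Euc N →L[ℝ] ℝ) :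
    ‖L‖ ≤ ∑ i, ‖L (EuclideanSpace.single i 1)‖ := by
  refine L.opNorm_le_bound (Finset.sum_nonneg fun i _ => norm_nonneg _) fun x => ?_
  have hx : x = ∑ i, x i • EuclideanSpace.single i (1 : ℝ) := by
    ext j; simp [Finset.sum_apply, Pi.single_apply]
  conv_lhs => rw [hx]
  rw [map_sum, Finset.sum_mul]
  refine (norm_sum_le _ _).trans (Finset.sum_le_sum fun i _ => ?_)
  rw [map_smul, norm_smul, mul_comm]
  gcongr
  exact PiLp.norm_apply_le x i

lemma abs_le_gradNorm1 {N : ℕ} (g : Fin N → Euc N → ℝ) (i : Fin N) (x : Euc N) :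
    ‖g i x‖ ≤ gradNorm1 g x := by
  unfold gradNorm1
  apply Real.le_sqrt_of_sq_le
  rw [Real.norm_eq_abs, sq_abs]
  exact Finset.single_le_sum (f := fun i => g i x ^ 2) (fun i _ => sq_nonneg _) (Finset.mem_univ i)

lemma gradNorm1_nonneg {N : ℕ} (g : Fin N → Euc N → ℝ) (x : Euc N) : 0 ≤ gradNorm1 g x :=
  Real.sqrt_nonneg _

lemma moll_fderiv_bound {N : ℕ} (n : ℕ) {u : Euc N → ℝ} {g : Fin N → Euc N → ℝ}
    (h : ∀ i, IsWeakPartialDeriv i u (g i)) (x : Euc N) :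
    ‖fderiv ℝ (moll n u) x‖ₑ ≤
      N * ∫⁻ t, ENNReal.ofReal (mker N n t) * ‖gradNorm1 g (x - t)‖ₑ := by
  have h1 := ENNReal.ofReal_le_ofReal (norm_clm_le_sum (fderiv ℝ (moll n u) x))
  rw [ofReal_norm, ENNReal.ofReal_sum_of_nonneg (fun i _ => norm_nonneg _)] at h1
  refine h1.trans ?_
  calc _ ≤ ∑ i : Fin N, ∫⁻ t, ENNReal.ofReal (mker N n t) * ‖gradNorm1 g (x - t)‖ₑ := by
        refine Finset.sum_le_sum fun i _ => ?_
        rw [ofReal_norm, moll_fderiv n (h i)]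
        refine (moll_enorm_le n _ x).trans ?_
        refine lintegral_mono fun t => ?_
        dsimp only
        gcongr
        rw [enorm_le_iff_norm_le, Real.norm_of_nonneg (gradNorm1_nonneg _ _)]
        exact abs_le_gradNorm1 g i _
    _ = _ := by simp

lemma gradNorm1_aesm {N : ℕ} {g : Fin N → Euc N → ℝ}
    (h : ∀ i, AEStronglyMeasurable (g i) volume) : AEStronglyMeasurable (gradNorm1 g) volume := by
  unfold gradNorm1
  have : AEMeasurable (fun x => ∑ i, g i x ^ 2) volume :=
    Finset.aemeasurable_fun_sum _ fun i _ => (h i).aemeasurable.pow_const 2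
  exact (this.sqrt).aestronglyMeasurable

/-- gradient energy bound -/
lemma moll_grad_energy {N : ℕ} (s : ℝ) {p : ℝ} (hp : 1 ≤ p) :
    ∃ C : ℝ≥0∞, C ≠ ∞ ∧ ∀ (n : ℕ) (u : Euc N → ℝ) (g : Fin N → Euc N → ℝ),
    (∀ i, IsWeakPartialDeriv i u (g i)) →
    ∫⁻ z, Wt (-s * p - N) z * ‖fderiv ℝ (moll n u) z‖ₑ ^ p ≤
      C * ∫⁻ z, Wt (-s * p - N) z * ‖gradNorm1 g z‖ₑ ^ p := by
  have hp0 : 0 < p := by linarith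
  refine ⟨(N : ℝ≥0∞) ^ p * ENNReal.ofReal (2 ^ |-s * p - N|), ENNReal.mul_ne_top
    (ENNReal.rpow_ne_top_of_nonneg hp0.le (by simp)) ENNReal.ofReal_ne_top, fun n u g h => ?_⟩
  have hg : AEMeasurable (fun z => ‖gradNorm1 g z‖ₑ) volume :=
    (gradNorm1_aesm fun i => (h i).2.1.aestronglyMeasurable).enorm
  calc _ ≤ ∫⁻ z, (N : ℝ≥0∞) ^ p * (Wt (-s * p - N) z *
        (∫⁻ t, ENNReal.ofReal (mker N n t) * ‖gradNorm1 g (z - t)‖ₑ) ^ p) := by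
        refine lintegral_mono fun z => ?_
        dsimp only
        rw [mul_left_comm, ← ENNReal.mul_rpow_of_nonneg _ _ hp0.le]
        gcongr
        exact moll_fderiv_bound n h z
    _ ≤ _ := by
        rw [lintegral_const_mul' _ _ (ENNReal.rpow_ne_top_of_nonneg hp0.le (by simp)), mul_assoc]
        gcongr
        exact moll_weight n _ hp hg

lemma liminf_le_const {f : ℕ → ℝ≥0∞} {c : ℝ≥0∞} (h : ∀ n, f n ≤ c) : liminf f atTop ≤ c := by
  have := liminf_le_liminf (f := atTop) (u := f) (v := fun _ => c) (Eventually.of_forall h)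
  rwa [liminf_const] at this

/-- gradient energy -/
def Eg {N : ℕ} (s p : ℝ) (g : Fin N → Euc N → ℝ) : ℝ≥0∞ :=
  ∫⁻ z, Wt (-s * p - N) z * ‖gradNorm1 g z‖ₑ ^ p

lemma hardy_weak {N : ℕ} (s p ρ : ℝ) (hs : -1 < s) (hp : 1 ≤ p) (hρ : 0 < ρ) :
    ∃ C : ℝ≥0∞, C ≠ ∞ ∧ ∀ (u : Euc N → ℝ) (g : Fin N → Euc N → ℝ),
      LocallyIntegrable u volume →
      (∀ i, IsWeakPartialDeriv i u (g i)) →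
      ∫⁻ x, Wt (-(s + 1) * p - N) x * ∫⁻ y in ball 0 ρ, ‖u x - u y‖ₑ ^ p ≤ C * Eg s p g := by
  have hp0 : 0 < p := by linarith
  obtain ⟨C1, hC1, h1⟩ := hardy_smooth (N := N) s p ρ hs hp hρ
  obtain ⟨C2, hC2, h2⟩ := moll_grad_energy (N := N) s hp
  refine ⟨C1 * C2, ENNReal.mul_ne_top hC1 hC2, fun u g hu h => ?_⟩
  have hc : ∀ n, ContDiff ℝ 1 (moll n u) := fun n => moll_contDiff n hu
  have hb : ∀ n, ∫⁻ x, Wt (-(s + 1) * p - N) x * ∫⁻ y in ball 0 ρ, ‖moll n u x - moll n u y‖ₑ ^ p ≤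
      C1 * C2 * Eg s p g := fun n => by
    refine (h1 _ (hc n)).trans ?_
    rw [mul_assoc]; gcongr
    exact h2 n u g h
  have ht := moll_tendsto hu
  have hjm : ∀ n, Measurable fun z : Euc N × Euc N => ‖moll n u z.1 - moll n u z.2‖ₑ ^ p := by
    intro n
    have hcn := (hc n).continuous
    have : Continuous fun z : Euc N × Euc N => moll n u z.1 - moll n u z.2 := by fun_prop
    exact this.enorm.measurable.pow_const p
  have inner : ∀ᵐ x, Wt (-(s + 1) * p - N) x * ∫⁻ y in ball 0 ρ, ‖u x - u y‖ₑ ^ p ≤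
      liminf (fun n => Wt (-(s + 1) * p - N) x *
        ∫⁻ y in ball 0 ρ, ‖moll n u x - moll n u y‖ₑ ^ p) atTop := by
    filter_upwards [ht] with x hx
    simp_rw [← lintegral_const_mul' _ _ (Wt_ne_top (-(s + 1) * p - N) x)]
    refine le_trans ?_ (lintegral_liminf_le' (fun n => ?_))
    · refine lintegral_mono_ae ?_
      filter_upwards [ae_restrict_of_ae ht] with y hy
      have t1 : Tendsto (fun n => ‖moll n u x - moll n u y‖ₑ ^ p) atTop (𝓝 (‖u x - u y‖ₑ ^ p)) :=
        (ENNReal.continuous_rpow_const.tendsto _).comp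
          ((continuous_enorm.tendsto _).comp (hx.sub hy))
      have t2 := ENNReal.Tendsto.const_mul t1 (Or.inr (Wt_ne_top (-(s + 1) * p - N) x))
      rw [t2.liminf_eq]
    · exact (((hjm n).comp (measurable_prodMk_left (x := x))).const_mul _).aemeasurable
  calc _ ≤ ∫⁻ x, liminf (fun n => Wt (-(s + 1) * p - N) x *
        ∫⁻ y in ball 0 ρ, ‖moll n u x - moll n u y‖ₑ ^ p) atTop := lintegral_mono_ae inner
    _ ≤ liminf (fun n => ∫⁻ x, Wt (-(s + 1) * p - N) x *
        ∫⁻ y in ball 0 ρ, ‖moll n u x - moll n u y‖ₑ ^ p) atTop :=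
        lintegral_liminf_le' fun n =>
          ((measurable_Wt _).mul (hjm n).lintegral_prod_right').aemeasurable
    _ ≤ _ := liminf_le_const hb

lemma avg_bound {N : ℕ} {p ρ : ℝ} (hp : 1 ≤ p) (hρ : 0 < ρ) :
    ∃ C : ℝ≥0∞, C ≠ ∞ ∧ ∀ (u : Euc N → ℝ), LocallyIntegrable u volume → ∀ x,
      ‖u x - ballAvg ρ u‖ₑ ^ p ≤ C * ∫⁻ y in ball 0 ρ, ‖u x - u y‖ₑ ^ p := by
  have hp0 : 0 < p := by linarith
  set B := ball (0 : Euc N) ρ with hB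
  have hB0 : volume B ≠ 0 := (measure_ball_pos volume _ hρ).ne'
  have hBt : volume B ≠ ∞ := measure_ball_lt_top.ne
  have h1p : 0 ≤ 1 - 1 / p := by rw [sub_nonneg, div_le_one hp0]; exact hp
  refine ⟨((volume B)⁻¹ * volume B ^ (1 - 1 / p)) ^ p, ENNReal.rpow_ne_top_of_nonneg hp0.le
    (ENNReal.mul_ne_top (ENNReal.inv_ne_top.2 hB0) (ENNReal.rpow_ne_top_of_nonneg h1p hBt)),
    fun u hu x => ?_⟩
  have hIntU : IntegrableOn u B := (hu.integrableOn_isCompact (isCompact_closedBall 0 ρ)).mono_set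
    ball_subset_closedBall
  set m := (volume B).toReal with hm
  have hm0 : 0 < m := ENNReal.toReal_pos hB0 hBt
  have hfin : IsFiniteMeasure (volume.restrict B) :=
    ⟨by rw [Measure.restrict_apply_univ]; exact hBt.lt_top⟩
  have e1 : u x - ballAvg ρ u = m⁻¹ * ∫ y in B, (u x - u y) := by
    rw [integral_sub (integrable_const _) hIntU, setIntegral_const, ballAvg, mul_sub]
    simp only [smul_eq_mul, measureReal_def]
    rw [← hB, ← hm, ← mul_assoc, inv_mul_cancel₀ hm0.ne', one_mul]
  have e2 : ‖u x - ballAvg ρ u‖ₑ ≤ (volume B)⁻¹ * ∫⁻ y in B, ‖u x - u y‖ₑ := by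
    rw [e1, enorm_mul]
    gcongr
    · rw [← ofReal_norm, Real.norm_of_nonneg (by positivity), ENNReal.ofReal_inv_of_pos hm0, hm,
        ENNReal.ofReal_toReal hBt]
    · exact enorm_integral_le_lintegral_enorm _
  have hmeas : AEMeasurable (fun y => ‖u x - u y‖ₑ) (volume.restrict B) :=
    (aestronglyMeasurable_const.sub hIntU.aestronglyMeasurable).enorm
  have e3 := holder_one _ hmeas hp
  rw [Measure.restrict_apply_univ] at e3
  calc _ ≤ ((volume B)⁻¹ * ((∫⁻ y in B, ‖u x - u y‖ₑ ^ p) ^ (1 / p) * volume B ^ (1 - 1 / p))) ^ p := by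
        gcongr; exact e2.trans (by gcongr)
    _ = (((volume B)⁻¹ * volume B ^ (1 - 1 / p)) * (∫⁻ y in B, ‖u x - u y‖ₑ ^ p) ^ (1 / p)) ^ p := by
        congr 1; ring
    _ = _ := by
        rw [ENNReal.mul_rpow_of_nonneg _ _ hp0.le, ← ENNReal.rpow_mul _ (1 / p),
          one_div_mul_cancel hp0.ne', ENNReal.rpow_one]

lemma lp_est {N : ℕ} (s p ρ : ℝ) (hs : -1 < s) (hp : 1 ≤ p) (hρ : 0 < ρ) :
    ∃ C : ℝ≥0∞, C ≠ ∞ ∧ ∀ (u : Euc N → ℝ) (g : Fin N → Euc N → ℝ),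
      LocallyIntegrable u volume →
      (∀ i, IsWeakPartialDeriv i u (g i)) →
      ∫⁻ x, Wt (-(s + 1) * p - N) x * ‖u x - ballAvg ρ u‖ₑ ^ p ≤ C * Eg s p g := by
  obtain ⟨C1, hC1, h1⟩ := hardy_weak (N := N) s p ρ hs hp hρ
  obtain ⟨C2, hC2, h2⟩ := avg_bound (N := N) hp hρ
  refine ⟨C2 * C1, ENNReal.mul_ne_top hC2 hC1, fun u g hu h => ?_⟩
  calc _ ≤ ∫⁻ x, C2 * (Wt (-(s + 1) * p - N) x * ∫⁻ y in ball 0 ρ, ‖u x - u y‖ₑ ^ p) := by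
        refine lintegral_mono fun x => ?_
        dsimp only
        rw [mul_left_comm]
        gcongr
        exact h2 u hu x
    _ ≤ _ := by
        rw [lintegral_const_mul' _ _ hC2, mul_assoc]
        gcongr
        exact h1 u g hu h

lemma integral_pderiv_zero {N : ℕ} (i : Fin N) {φ : Euc N → ℝ} (hφ : ContDiff ℝ (⊤ : ℕ∞) φ)
    (hc : HasCompactSupport φ) : ∫ x, fderiv ℝ φ x (EuclideanSpace.single i 1) = 0 := by
  have hφ1 : ContDiff ℝ 1 φ := hφ.of_le (by exact_mod_cast le_top)
  have hd : Continuous fun x => fderiv ℝ φ x (EuclideanSpace.single i (1 : ℝ)) :=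
    (hφ1.continuous_fderiv one_ne_zero).clm_apply continuous_const
  have hdc : HasCompactSupport fun x => fderiv ℝ φ x (EuclideanSpace.single i (1 : ℝ)) :=
    hc.fderiv_apply ℝ _
  have := integral_mul_fderiv_eq_neg_fderiv_mul_of_integrable (μ := (volume : Measure (Euc N)))
    (f := fun _ => (1 : ℝ)) (g := φ) (v := EuclideanSpace.single i 1) (by simp)
    (by simpa using hd.integrable_of_hasCompactSupport hdc)
    (by simpa using hφ1.continuous.integrable_of_hasCompactSupport hc)
    (fun x _ => by fun_prop) (fun x _ => hφ1.differentiable one_ne_zero x)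
  simpa using this

lemma pderiv_cont {N : ℕ} (i : Fin N) {φ : Euc N → ℝ} (hφ : ContDiff ℝ (⊤ : ℕ∞) φ) :
    Continuous fun x => fderiv ℝ φ x (EuclideanSpace.single i (1 : ℝ)) := by
  have hφ1 : ContDiff ℝ 1 φ := hφ.of_le (by exact_mod_cast le_top)
  exact (hφ1.continuous_fderiv one_ne_zero).clm_apply continuous_const

lemma li_mul_integrable {N : ℕ} {u φ : Euc N → ℝ} (hu : LocallyIntegrable u volume)
    (hφ : Continuous φ) (hc : HasCompactSupport φ) : Integrable (fun x => u x * φ x) := by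
  have := hu.integrable_smul_left_of_hasCompactSupport hφ hc
  simpa [mul_comm] using this

lemma weak_sub_const {N : ℕ} {i : Fin N} {u g : Euc N → ℝ} (h : IsWeakPartialDeriv i u g) (c : ℝ) :
    IsWeakPartialDeriv i (fun x => u x - c) g := by
  refine ⟨h.1.sub (locallyIntegrable_const c), h.2.1, fun φ hφ hc => ?_⟩
  rw [← h.2.2 φ hφ hc]
  simp only [pderivList]
  have hdc : HasCompactSupport fun x => fderiv ℝ φ x (EuclideanSpace.single i (1 : ℝ)) :=
    hc.fderiv_apply ℝ _
  simp_rw [sub_mul]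
  rw [integral_sub (li_mul_integrable h.1 (pderiv_cont i hφ) hdc)
    (((pderiv_cont i hφ).integrable_of_hasCompactSupport hdc).const_mul c), integral_const_mul,
    integral_pderiv_zero i hφ hc]
  simp

lemma eLpNorm_wt_eq {N : ℕ} (s : ℝ) {p : ℝ} (hp0 : 0 < p) (f : Euc N → ℝ) :
    eLpNorm (fun x => wt N s (ENNReal.ofReal p) x * f x) (ENNReal.ofReal p) volume =
      (∫⁻ z, Wt (-s * p - N) z * ‖f z‖ₑ ^ p) ^ (1 / p) := by
  rw [eLpNorm_ofReal_eq _ _ hp0]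
  congr 2; ext x
  rw [enorm_wt_mul, ENNReal.toReal_ofReal hp0.le, ENNReal.mul_rpow_of_nonneg _ _ hp0.le,
    Wt_rpow _ hp0.le]
  congr 2
  field_simp

lemma wt_continuous {N : ℕ} (s : ℝ) (q : ℝ≥0∞) : Continuous (wt N s q) := by
  unfold wt
  refine Continuous.rpow_const (by fun_prop) fun x => Or.inl (one_add_norm_pos x).ne'

lemma main_est {N : ℕ} (hN : 1 ≤ N) (s p ρ : ℝ) (hs : -1 < s) (hp : 1 ≤ p) (hρ : 0 < ρ)
    {q : ℝ≥0∞} (hq : q ∈ Ijp N 1 p) :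
    ∃ C : ℝ≥0∞, C ≠ ∞ ∧ ∀ (u : Euc N → ℝ) (g : Fin N → Euc N → ℝ),
      LocallyIntegrable u volume →
      (∀ i, IsWeakPartialDeriv i u (g i)) →
      eLpNorm (fun x => wt N (s + 1) q x * (u x - ballAvg ρ u)) q volume ≤
        C * eLpNorm (fun x => wt N s (ENNReal.ofReal p) x * gradNorm1 g x)
          (ENNReal.ofReal p) volume := by
  have hp0 : 0 < p := by linarith
  obtain ⟨C1, hC1, h1⟩ := smooth_sobolev hN s hp hq
  obtain ⟨C2, hC2, h2⟩ := moll_grad_energy (N := N) s hp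
  obtain ⟨C3, hC3, h3⟩ := lp_est (N := N) s p ρ hs hp hρ
  set K := ENNReal.ofReal (2 ^ |-(s + 1) * p - N|) with hK
  refine ⟨C1 * (K * C3 + C2) ^ (1 / p), ENNReal.mul_ne_top hC1
    (ENNReal.rpow_ne_top_of_nonneg (by positivity) (ENNReal.add_ne_top.2
      ⟨ENNReal.mul_ne_top ENNReal.ofReal_ne_top hC3, hC2⟩)), fun u g hu h => ?_⟩
  set v : Euc N → ℝ := fun x => u x - ballAvg ρ u with hv
  have hvl : LocallyIntegrable v volume := hu.sub (locallyIntegrable_const _)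
  have hvg : ∀ i, IsWeakPartialDeriv i v (g i) := fun i => weak_sub_const (h i) _
  rw [eLpNorm_wt_eq s hp0]
  have hb : ∀ n, eLpNorm (fun x => wt N (s + 1) q x * moll n v x) q volume ≤
      C1 * (K * C3 + C2) ^ (1 / p) * Eg s p g ^ (1 / p) := by
    intro n
    have hcn := moll_contDiff n hvl
    refine (h1 _ hcn).trans ?_
    rw [mul_assoc, ← ENNReal.mul_rpow_of_nonneg _ _ (by positivity : 0 ≤ 1 / p)]
    gcongr
    unfold Phi
    have hmm : Measurable fun z => Wt (-(s + 1) * p - N) z * ‖moll n v z‖ₑ ^ p :=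
      (measurable_Wt _).mul (hcn.continuous.enorm.measurable.pow_const _)
    rw [lintegral_add_left hmm, add_mul]
    gcongr
    · calc _ ≤ ∫⁻ x, Wt (-(s + 1) * p - N) x *
            (∫⁻ t, ENNReal.ofReal (mker N n t) * ‖v (x - t)‖ₑ) ^ p := by
            refine lintegral_mono fun x => ?_
            dsimp only
            gcongr
            exact moll_enorm_le n v x
        _ ≤ K * ∫⁻ x, Wt (-(s + 1) * p - N) x * ‖v x‖ₑ ^ p :=
            moll_weight n _ hp (f := fun x => ‖v x‖ₑ) hvl.aestronglyMeasurable.enorm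
        _ ≤ _ := by
            rw [mul_assoc]; gcongr
            exact h3 u g hu h
    · exact h2 n v g hvg
  refine (Lp.eLpNorm_lim_le_liminf_eLpNorm (f := fun n x => wt N (s + 1) q x * moll n v x)
    (fun n => ?_) _ ?_).trans (liminf_le_const hb)
  · exact ((wt_continuous _ _).mul (moll_contDiff n hvl).continuous).aestronglyMeasurable
  · filter_upwards [moll_tendsto hvl] with x hx
    exact hx.const_mul _

lemma gradNorm1_le_sum {N : ℕ} (g : Fin N → Euc N → ℝ) (x : Euc N) :
    gradNorm1 g x ≤ ∑ i, ‖g i x‖ := by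
  unfold gradNorm1
  refine Real.sqrt_le_iff.2 ⟨Finset.sum_nonneg fun i _ => norm_nonneg _, ?_⟩
  have := Finset.sum_sq_le_sq_sum_of_nonneg (s := Finset.univ) (f := fun i => ‖g i x‖)
    (fun i _ => norm_nonneg _)
  simpa using this

lemma wt_pos {N : ℕ} (s : ℝ) (q : ℝ≥0∞) (x : Euc N) : 0 < wt N s q x := by
  unfold wt; positivity

lemma grad_memLs {N : ℕ} {s : ℝ} {p : ℝ≥0∞} {g : Fin N → Euc N → ℝ}
    (hm : ∀ i, AEStronglyMeasurable (g i) volume)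
    (h : ∀ i, MemLs N s p (g i)) : MemLs N s p (gradNorm1 g) := by
  have h1 : MemLp (fun x => ∑ i, ‖wt N s p x * g i x‖) p volume :=
    memLp_finsetSum Finset.univ fun i _ => (h i).norm
  refine h1.mono ((wt_continuous s p).aestronglyMeasurable.mul (gradNorm1_aesm hm)) ?_
  refine Eventually.of_forall fun x => ?_
  rw [norm_mul, Real.norm_of_nonneg (gradNorm1_nonneg g x),
    Real.norm_of_nonneg (Finset.sum_nonneg fun i _ => norm_nonneg _)]
  simp_rw [norm_mul]
  rw [← Finset.mul_sum]
  gcongr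
  exact gradNorm1_le_sum g x

lemma const_memLs {N : ℕ} {s : ℝ} (hs : -1 < s) {q : ℝ≥0∞} (hq : 1 ≤ q) (c : ℝ) :
    MemLs N (s + 1) q (fun _ => c) := by
  unfold MemLs
  have key : MemLp (wt N (s + 1) q) q volume := by
    have hae := (wt_continuous (N := N) (s + 1) q).aestronglyMeasurable (μ := volume)
    rcases eq_or_ne q ∞ with rfl | hqt
    · refine memLp_top_of_bound hae 1 (Eventually.of_forall fun x => ?_)
      rw [Real.norm_of_nonneg (wt_pos _ _ _).le]
      unfold wt
      refine Real.rpow_le_one_of_one_le_of_nonpos (by linarith [norm_nonneg x]) ?_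
      simp; linarith
    · have hq0 : q ≠ 0 := (lt_of_lt_of_le one_pos hq).ne'
      have hqr : 0 < q.toReal := ENNReal.toReal_pos hq0 hqt
      rw [← integrable_norm_rpow_iff hae hq0 hqt]
      have hr : ((Module.finrank ℝ (Euc N) : ℕ) : ℝ) < (s + 1) * q.toReal + N := by
        simp; exact mul_pos (by linarith) hqr
      refine (integrable_one_add_norm (μ := (volume : Measure (Euc N))) hr).congr
        (Eventually.of_forall fun x => ?_)
      dsimp only
      rw [Real.norm_of_nonneg (wt_pos _ _ _).le]
      unfold wt
      rw [← Real.rpow_mul (by positivity)]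
      congr 1
      field_simp
      ring
  exact key.mul_const c

lemma part1 {N : ℕ} (hN : 1 ≤ N) (s p ρ : ℝ) (hs : -1 < s) (hp : 1 ≤ p) (hρ : 0 < ρ) :
    (∀ q ∈ Ijp N 1 p, ∃ C : ℝ, 0 < C ∧
      ∀ (u : Euc N → ℝ) (g : Fin N → Euc N → ℝ),
        (∀ i, IsWeakPartialDeriv i u (g i)) →
        (∀ i, MemLs N s (ENNReal.ofReal p) (g i)) →
        MemLs N (s + 1) q u ∧
          LsNorm N (s + 1) q (fun x => u x - ballAvg ρ u)
            ≤ C * LsNorm N s (ENNReal.ofReal p) (gradNorm1 g)) := by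
  intro q hq
  obtain ⟨C, hC, h⟩ := main_est hN s p ρ hs hp hρ hq
  have hq1 : 1 ≤ q := le_trans (by simpa using hp) (Ijp_ge hq)
  refine ⟨C.toReal + 1, by positivity, fun u g hw hg => ?_⟩
  have hu : LocallyIntegrable u volume := (hw ⟨0, hN⟩).1
  have hG := grad_memLs (fun i => (hw i).2.1.aestronglyMeasurable) hg
  have hE := h u g hu hw
  have hfin : C * eLpNorm (fun x => wt N s (ENNReal.ofReal p) x * gradNorm1 g x)
          (ENNReal.ofReal p) volume < ∞ := ENNReal.mul_lt_top hC.lt_top hG.2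
  constructor
  · have h1 : MemLp (fun x => wt N (s + 1) q x * (u x - ballAvg ρ u)) q volume :=
      ⟨(wt_continuous _ q).aestronglyMeasurable.mul
        (hu.aestronglyMeasurable.sub aestronglyMeasurable_const), hE.trans_lt hfin⟩
    have h2 := const_memLs (N := N) hs hq1 (ballAvg ρ u)
    refine (h1.add h2).congr_norm ((wt_continuous _ q).aestronglyMeasurable.mul
      hu.aestronglyMeasurable) (Eventually.of_forall fun x => ?_)
    simp only [Pi.add_apply]
    congr 1; ring
  · have := ENNReal.toReal_mono hfin.ne hE
    rw [ENNReal.toReal_mul] at this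
    refine this.trans ?_
    have h0 : 0 ≤ LsNorm N s (ENNReal.ofReal p) (gradNorm1 g) := ENNReal.toReal_nonneg
    unfold LsNorm at *
    nlinarith

lemma weak_mul {N : ℕ} {i : Fin N} {u g η : Euc N → ℝ} (h : IsWeakPartialDeriv i u g)
    (hη : ContDiff ℝ (⊤ : ℕ∞) η) :
    IsWeakPartialDeriv i (fun x => η x * u x)
      (fun x => η x * g x + u x * fderiv ℝ η x (EuclideanSpace.single i 1)) := by
  have hd := pderiv_cont i hη
  have l1 : LocallyIntegrable (fun x => η x * u x) volume := by
    have := h.1.locallyIntegrableOn Set.univ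
    have := this.continuousOn_mul hη.continuous.continuousOn isOpen_univ.isLocallyClosed
    exact locallyIntegrableOn_univ.1 this
  have l2 : LocallyIntegrable (fun x => η x * g x) volume := by
    have := h.2.1.locallyIntegrableOn Set.univ
    have := this.continuousOn_mul hη.continuous.continuousOn isOpen_univ.isLocallyClosed
    exact locallyIntegrableOn_univ.1 this
  have l3 : LocallyIntegrable
      (fun x => u x * fderiv ℝ η x (EuclideanSpace.single i 1)) volume := by
    have := h.1.locallyIntegrableOn Set.univ
    have := this.mul_continuousOn hd.continuousOn isOpen_univ.isLocallyClosed
    exact locallyIntegrableOn_univ.1 this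
  refine ⟨l1, l2.add l3, fun φ hφ hc => ?_⟩
  have key := h.2.2 (fun x => η x * φ x) (hη.mul hφ) hc.mul_left
  simp only [pderivList, List.length_singleton, pow_one] at key ⊢
  have hdη : Differentiable ℝ η := hη.differentiable (by simp)
  have hdφ : Differentiable ℝ φ := hφ.differentiable (by simp)
  have hcd : HasCompactSupport fun x => fderiv ℝ φ x (EuclideanSpace.single i (1 : ℝ)) :=
    hc.fderiv_apply ℝ _
  have hd2 := pderiv_cont i hφ
  have e1 : ∀ x, fderiv ℝ (fun x => η x * φ x) x (EuclideanSpace.single i 1) =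
      η x * fderiv ℝ φ x (EuclideanSpace.single i 1) +
      φ x * fderiv ℝ η x (EuclideanSpace.single i 1) := by
    intro x
    rw [fderiv_fun_mul (hdη x) (hdφ x)]
    simp
  have i1 := li_mul_integrable l1 hd2 hcd
  have i2 := li_mul_integrable l3 hφ.continuous hc
  have i3 := li_mul_integrable l2 hφ.continuous hc
  have e2 : ∫ x, u x * fderiv ℝ (fun x => η x * φ x) x (EuclideanSpace.single i 1) =
      (∫ x, η x * u x * fderiv ℝ φ x (EuclideanSpace.single i 1)) +
      ∫ x, u x * fderiv ℝ η x (EuclideanSpace.single i 1) * φ x := by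
    rw [← integral_add i1 i2]
    congr 1; ext x
    rw [e1]; ring
  have e3 : ∫ x, (η x * g x + u x * fderiv ℝ η x (EuclideanSpace.single i 1)) * φ x =
      (∫ x, g x * (η x * φ x)) +
      ∫ x, u x * fderiv ℝ η x (EuclideanSpace.single i 1) * φ x := by
    simp_rw [add_mul]
    rw [integral_add i3 i2]
    congr 2; ext x; ring
  rw [e2] at key
  rw [e3]
  linarith

lemma cutoff (N : ℕ) : ∃ M : ℝ, 0 ≤ M ∧ ∀ R : ℝ, 1 ≤ R → ∃ η : Euc N → ℝ,
    ContDiff ℝ (⊤ : ℕ∞) η ∧ (∀ x, 0 ≤ η x) ∧ (∀ x, η x ≤ 1) ∧ (∀ x, ‖x‖ ≤ R → η x = 0) ∧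
    (∀ x, 2 * R ≤ ‖x‖ → η x = 1) ∧
    (∀ x, ‖x‖ < R → fderiv ℝ η x = 0) ∧ (∀ x, ‖fderiv ℝ η x‖ ≤ M / (1 + ‖x‖)) := by
  let χ : ContDiffBump (0 : Euc N) := ⟨1, 2, by norm_num, by norm_num⟩
  have hχ : ContDiff ℝ (⊤ : ℕ∞) χ := χ.contDiff
  have hχ1 : ContDiff ℝ 1 χ := χ.contDiff
  obtain ⟨M, hM⟩ := (hχ1.continuous_fderiv one_ne_zero).bounded_above_of_compact_support
    (χ.hasCompactSupport.fderiv (𝕜 := ℝ))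
  have hM0 : 0 ≤ M := (norm_nonneg _).trans (hM 0)
  refine ⟨3 * M, by positivity, fun R hR => ?_⟩
  have hR0 : 0 < R := by linarith
  have hη : ContDiff ℝ (⊤ : ℕ∞) fun x : Euc N => 1 - χ (R⁻¹ • x) :=
    contDiff_const.sub (hχ.comp (contDiff_const_smul R⁻¹))
  have hnorm : ∀ x : Euc N, ‖R⁻¹ • x‖ = ‖x‖ / R := fun x => by
    rw [norm_smul, Real.norm_of_nonneg (by positivity)]; field_simp
  have z0 : ∀ x : Euc N, ‖x‖ ≤ R → 1 - χ (R⁻¹ • x) = 0 := fun x hx => by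
    rw [χ.one_of_mem_closedBall, sub_self]
    rw [mem_closedBall_zero_iff, hnorm]
    exact (div_le_one hR0).2 hx
  have z1 : ∀ x : Euc N, 2 * R ≤ ‖x‖ → 1 - χ (R⁻¹ • x) = 1 := fun x hx => by
    rw [χ.zero_of_le_dist, _root_.sub_zero]
    rw [dist_zero_right, hnorm]
    exact (le_div_iff₀ hR0).2 hx
  refine ⟨_, hη, fun x => sub_nonneg.2 χ.le_one, fun x => by linarith [χ.nonneg' (R⁻¹ • x)], z0, z1,
    fun x hx => ?_, fun x => ?_⟩
  · have : (fun x : Euc N => 1 - χ (R⁻¹ • x)) =ᶠ[𝓝 x] fun _ => 0 := by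
      filter_upwards [(isOpen_lt continuous_norm continuous_const).mem_nhds hx] with y hy
      exact z0 y (le_of_lt hy)
    rw [this.fderiv_eq]; simp
  · rcases le_or_gt ‖x‖ (2 * R) with h | h
    · have e : fderiv ℝ (fun x : Euc N => 1 - χ (R⁻¹ • x)) x = -(R⁻¹ • fderiv ℝ χ (R⁻¹ • x)) := by
        rw [fderiv_const_sub, fderiv_comp_smul]
      rw [e, norm_neg, norm_smul, Real.norm_of_nonneg (by positivity)]
      have := hM (R⁻¹ • x)
      calc R⁻¹ * ‖fderiv ℝ χ (R⁻¹ • x)‖ ≤ R⁻¹ * M := by gcongr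
        _ ≤ _ := by
          rw [inv_mul_eq_div, div_le_div_iff₀ hR0 (by positivity)]
          nlinarith
    · have : (fun x : Euc N => 1 - χ (R⁻¹ • x)) =ᶠ[𝓝 x] fun _ => 1 := by
        filter_upwards [(isOpen_lt continuous_const continuous_norm).mem_nhds h] with y hy
        exact z1 y (le_of_lt hy)
      rw [this.fderiv_eq]; simp; positivity

lemma tail_tendsto {N : ℕ} {p : ℝ} (hp : 1 ≤ p) {F : Euc N → ℝ}
    (hF : MemLp F (ENNReal.ofReal p) volume) :
    Tendsto (fun n : ℕ => eLpNorm ({x : Euc N | (n : ℝ) ≤ ‖x‖}.indicator F)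
      (ENNReal.ofReal p) volume) atTop (𝓝 0) := by
  have hp0 : 0 < p := by linarith
  simp_rw [eLpNorm_ofReal_eq _ _ hp0]
  have hfin : ∫⁻ x, ‖F x‖ₑ ^ p ≠ ∞ := by
    have := hF.2
    rw [eLpNorm_ofReal_eq _ _ hp0] at this
    intro h
    rw [h, ENNReal.top_rpow_of_pos (by positivity)] at this
    exact lt_irrefl _ this
  have hm : ∀ n : ℕ, MeasurableSet {x : Euc N | (n : ℝ) ≤ ‖x‖} := fun n =>
    measurableSet_le measurable_const measurable_norm
  have : Tendsto (fun n : ℕ => ∫⁻ x, ‖{x : Euc N | (n : ℝ) ≤ ‖x‖}.indicator F x‖ₑ ^ p) atTop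
      (𝓝 (∫⁻ x : Euc N, 0)) := by
    refine tendsto_lintegral_of_dominated_convergence' (fun x => ‖F x‖ₑ ^ p) (fun n => ?_)
      (fun n => Eventually.of_forall fun x => ?_) hfin (Eventually.of_forall fun x => ?_)
    · exact (hF.1.indicator (hm n)).enorm.pow_const p
    · dsimp only
      gcongr
      rw [enorm_indicator_eq_indicator_enorm]
      exact Set.indicator_le_self _ _ _
    · refine tendsto_const_nhds.congr' ?_
      obtain ⟨k, hk⟩ := exists_nat_gt ‖x‖
      filter_upwards [eventually_ge_atTop k] with n hn
      rw [Set.indicator_of_notMem]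
      · simp [hp0]
      · have : (k : ℝ) ≤ n := by exact_mod_cast hn
        simp only [Set.mem_ofPred_eq, not_le]; linarith
  rw [lintegral_zero] at this
  have h2 := (ENNReal.continuous_rpow_const (y := 1 / p)).tendsto 0
  rw [ENNReal.zero_rpow_of_pos (by positivity)] at h2
  exact h2.comp this

lemma top_mem_Ijp {N : ℕ} {p : ℝ} (h : (N : ℝ) < p ∨ (p = 1 ∧ N = 1)) : ∞ ∈ Ijp N 1 p := by
  unfold Ijp
  rcases h with h | ⟨rfl, rfl⟩
  · rw [if_neg (by rintro ⟨h1, -⟩; simp at h1; linarith), if_neg (by simp; linarith)]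
    exact ⟨le_top, le_rfl⟩
  · simp

lemma self_mem_Ijp {N : ℕ} {p : ℝ} (h : (N : ℝ) < p ∨ (p = 1 ∧ N = 1)) :
    ENNReal.ofReal p ∈ Ijp N 1 p := by
  unfold Ijp
  rcases h with h | ⟨rfl, rfl⟩
  · rw [if_neg (by rintro ⟨h1, -⟩; simp at h1; linarith), if_neg (by simp; linarith)]
    exact ⟨le_rfl, le_top⟩
  · simp

lemma wt_succ {N : ℕ} (s : ℝ) (q : ℝ≥0∞) (x : Euc N) :
    wt N s q x / (1 + ‖x‖) = wt N (s + 1) q x := by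
  unfold wt
  have h : 0 < 1 + ‖x‖ := by positivity
  rw [← Real.rpow_sub_one h.ne']
  congr 1; ring

lemma ess_tail {N : ℕ} (hN : 1 ≤ N) (s p ρ : ℝ) (hs : -1 < s) (hp : 1 ≤ p) (hρ : 0 < ρ)
    (hpN : (N : ℝ) < p ∨ (p = 1 ∧ N = 1))
    (u : Euc N → ℝ) (g : Fin N → Euc N → ℝ)
    (hw : ∀ i, IsWeakPartialDeriv i u (g i))
    (hg : ∀ i, MemLs N s (ENNReal.ofReal p) (g i)) :
    ∃ ε : ℕ → ℝ≥0∞, Tendsto ε atTop (𝓝 0) ∧ ∀ᶠ n : ℕ in atTop,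
      ∀ᵐ x : Euc N, 2 * (n : ℝ) ≤ ‖x‖ → ‖wt N (s + 1) ∞ x * (u x - ballAvg ρ u)‖ₑ ≤ ε n := by
  obtain ⟨C, hC, h⟩ := main_est hN s p ρ hs hp hρ (top_mem_Ijp hpN)
  obtain ⟨M, hM0, hcut⟩ := cutoff N
  have hu : LocallyIntegrable u volume := (hw ⟨0, hN⟩).1
  set c := ballAvg ρ u with hc
  set P := ENNReal.ofReal p with hP
  have hP1 : 1 ≤ P := by simpa [hP] using hp
  obtain ⟨_, _, hpart⟩ := part1 hN s p ρ hs hp hρ P (self_mem_Ijp hpN)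
  have hv : MemLp (fun x => wt N (s + 1) P x * (u x - c)) P volume := by
    have h1 := (hpart u g hw hg).1
    have h2 := const_memLs (N := N) hs hP1 c
    refine (MemLp.sub h1 h2).congr_norm ?_ (Eventually.of_forall fun x => ?_)
    · exact (wt_continuous _ _).aestronglyMeasurable.mul
        (hu.aestronglyMeasurable.sub aestronglyMeasurable_const)
    · simp only [Pi.sub_apply]; congr 1; ring
  let F : Euc N → ℝ := fun x =>
    ∑ i : Fin N, (‖wt N s P x * g i x‖ + M * ‖wt N (s + 1) P x * (u x - c)‖)
  have hF : MemLp F P volume :=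
    memLp_finsetSum Finset.univ fun i _ => (hg i).norm.add (hv.norm.const_mul M)
  have hF0 : ∀ x, 0 ≤ F x := fun x => Finset.sum_nonneg fun i _ => by positivity
  refine ⟨fun n => C * eLpNorm ({x : Euc N | (n : ℝ) ≤ ‖x‖}.indicator F) P volume, ?_, ?_⟩
  · have := ENNReal.Tendsto.const_mul (tail_tendsto hp hF) (Or.inr hC)
    rwa [mul_zero] at this
  obtain ⟨k, hk⟩ := exists_nat_gt ρ
  filter_upwards [eventually_ge_atTop k, eventually_ge_atTop 1] with n hn hn1
  have hn1' : (1 : ℝ) ≤ n := by exact_mod_cast hn1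
  have hnk : (k : ℝ) ≤ n := by exact_mod_cast hn
  obtain ⟨η, hη, hη0, hη1, hz, ho, hd0, hd⟩ := hcut n hn1'
  have hw' := fun i => weak_mul (weak_sub_const (hw i) c) hη
  have hE := h _ _ (hw' ⟨0, hN⟩).1 hw'
  have havg : ballAvg ρ (fun x => η x * (u x - c)) = 0 := by
    unfold ballAvg
    rw [setIntegral_eq_zero_of_forall_eq_zero, mul_zero]
    intro x hx
    rw [mem_ball_zero_iff] at hx
    rw [hz x (by linarith), zero_mul]
  rw [havg] at hE
  have hgrad : eLpNorm (fun x => wt N s P x * gradNorm1 (fun i x => η x * g i x +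
      (u x - c) * fderiv ℝ η x (EuclideanSpace.single i 1)) x) P volume ≤
      eLpNorm ({x : Euc N | (n : ℝ) ≤ ‖x‖}.indicator F) P volume := by
    refine eLpNorm_mono fun x => ?_
    rw [norm_mul, Real.norm_of_nonneg (gradNorm1_nonneg _ x),
      Real.norm_of_nonneg (wt_pos s P x).le]
    have hwp := (wt_pos s P x).le
    refine (mul_le_mul_of_nonneg_left (gradNorm1_le_sum _ x) hwp).trans ?_
    by_cases hx : (n : ℝ) ≤ ‖x‖
    · rw [Set.indicator_of_mem (by exact hx), Real.norm_of_nonneg (hF0 x), Finset.mul_sum]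
      refine Finset.sum_le_sum fun i _ => ?_
      rw [norm_mul, Real.norm_of_nonneg hwp, norm_mul,
        Real.norm_of_nonneg (wt_pos (s + 1) P x).le, ← wt_succ]
      have b1 : ‖fderiv ℝ η x (EuclideanSpace.single i 1)‖ ≤ M / (1 + ‖x‖) := by
        refine ((fderiv ℝ η x).le_opNorm _).trans ?_
        simpa using hd x
      have b2 : ‖η x * g i x + (u x - c) * fderiv ℝ η x (EuclideanSpace.single i 1)‖ ≤
          ‖g i x‖ + ‖u x - c‖ * (M / (1 + ‖x‖)) := by
        refine (norm_add_le _ _).trans ?_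
        rw [norm_mul, norm_mul, Real.norm_of_nonneg (hη0 x)]
        refine add_le_add (mul_le_of_le_one_left (norm_nonneg _) (hη1 x)) ?_
        gcongr
      calc _ ≤ wt N s P x * (‖g i x‖ + ‖u x - c‖ * (M / (1 + ‖x‖))) := by gcongr
        _ = _ := by ring
    · rw [Set.indicator_of_notMem (by exact hx)]
      have hx' := not_le.1 hx
      simp [hz x hx'.le, hd0 x hx']
  have hae : ∀ᵐ x : Euc N, ‖wt N (s + 1) ∞ x * (η x * (u x - c) - 0)‖ₑ ≤
      C * eLpNorm ({x : Euc N | (n : ℝ) ≤ ‖x‖}.indicator F) P volume := by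
    have := hE.trans (mul_le_mul_right hgrad C)
    rw [eLpNorm_exponent_top] at this
    filter_upwards [ae_le_eLpNormEssSup (f := fun x => wt N (s + 1) ∞ x * (η x * (u x - c) - 0))
      (μ := volume)] with x hx
    exact hx.trans this
  filter_upwards [hae] with x hx hxn
  rwa [ho x hxn, one_mul, _root_.sub_zero] at hx

lemma part2 {N : ℕ} (hN : 1 ≤ N) (s p ρ : ℝ) (hs : -1 < s) (hp : 1 ≤ p) (hρ : 0 < ρ) :
    (((N : ℝ) < p ∨ (p = 1 ∧ N = 1)) →
      ∀ (u : Euc N → ℝ) (g : Fin N → Euc N → ℝ),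
        (∀ i, IsWeakPartialDeriv i u (g i)) →
        (∀ i, MemLs N s (ENNReal.ofReal p) (g i)) →
        ∃ v : Euc N → ℝ, v =ᵐ[volume] u ∧
          Tendsto (fun x : Euc N => ‖x‖ ^ (-(s + 1)) * v x) (cocompact (Euc N))
            (nhds 0)) := by
  classical
  intro hpN u g hw hg
  obtain ⟨ε, hε, hev⟩ := ess_tail hN s p ρ hs hp hρ hpN u g hw hg
  obtain ⟨n0, hn0⟩ := eventually_atTop.1 hev
  set c := ballAvg ρ u with hc
  let good : Euc N → Prop := fun x => ∀ n : ℕ, n0 ≤ n → 2 * (n : ℝ) ≤ ‖x‖ →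
    ‖wt N (s + 1) ∞ x * (u x - c)‖ₑ ≤ ε n
  have hgood : ∀ᵐ x, good x := by
    rw [ae_all_iff]
    intro n
    by_cases hn : n0 ≤ n
    · filter_upwards [hn0 n hn] with x hx _ using hx
    · exact Eventually.of_forall fun x h => absurd h hn
  have hnt := tendsto_norm_cocompact_atTop (E := Euc N)
  let v : Euc N → ℝ := fun x => if good x then u x else c
  refine ⟨v, ?_, ?_⟩
  · filter_upwards [hgood] with x hx
    exact if_pos hx
  have hvb : ∀ x (n : ℕ), n0 ≤ n → 2 * (n : ℝ) ≤ ‖x‖ →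
      ‖wt N (s + 1) ∞ x * (v x - c)‖ₑ ≤ ε n := by
    intro x n hn hx
    by_cases hg : good x
    · simp only [v, if_pos hg]; exact hg n hn hx
    · simp [v, if_neg hg]
  have t1 : Tendsto (fun x => wt N (s + 1) ∞ x * (v x - c)) (cocompact (Euc N)) (𝓝 0) := by
    rw [tendsto_zero_iff_norm_tendsto_zero, Metric.tendsto_nhds]
    intro δ hδ
    have : ∀ᶠ n in atTop, ε n < ENNReal.ofReal δ :=
      hε.eventually_lt_const (ENNReal.ofReal_pos.2 hδ)
    obtain ⟨n, hn1, hn2⟩ := (this.and (eventually_ge_atTop n0)).exists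
    filter_upwards [hnt.eventually_ge_atTop (2 * (n : ℝ))] with x hx
    have := (hvb x n hn2 hx).trans_lt hn1
    rw [← ofReal_norm, ENNReal.ofReal_lt_ofReal_iff hδ] at this
    rwa [dist_zero_right, norm_norm]
  have t2 : Tendsto (fun x : Euc N => ‖x‖ ^ (-(s + 1)) * (v x - c)) (cocompact (Euc N)) (𝓝 0) := by
    have t3 := (t1.norm.const_mul ((2 : ℝ) ^ (s + 1)))
    rw [norm_zero, mul_zero] at t3
    refine squeeze_zero_norm' ?_ t3
    filter_upwards [hnt.eventually_ge_atTop 1] with x hx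
    have hx0 : 0 < ‖x‖ := by linarith
    rw [norm_mul, norm_mul, ← mul_assoc, Real.norm_of_nonneg (by positivity),
      Real.norm_of_nonneg (wt_pos _ _ _).le]
    gcongr
    unfold wt
    rw [ENNReal.toReal_top, _root_.div_zero, _root_.sub_zero, Real.rpow_neg (by positivity),
      Real.rpow_neg (by positivity), ← div_eq_mul_inv, inv_eq_one_div,
      div_le_div_iff₀ (by positivity) (by positivity), one_mul,
      ← Real.mul_rpow (by norm_num) (by positivity)]
    exact Real.rpow_le_rpow (by positivity) (by linarith) (by linarith)
  have t4 : Tendsto (fun x : Euc N => ‖x‖ ^ (-(s + 1)) * c) (cocompact (Euc N)) (𝓝 0) := by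
    have := ((tendsto_rpow_neg_atTop (by linarith : 0 < s + 1)).comp hnt).mul_const c
    rwa [zero_mul] at this
  have := t2.add t4
  rw [add_zero] at this
  refine this.congr fun x => ?_
  ring

/-- Theorem 8(i). If `s > -1`, `1 ≤ p < ∞` and `∇u ∈ (L^p_s)^N`,
then `u ∈ L^q_{s+1}` for every `q ∈ I_{1,p}` and
`‖u - c_u‖_{L^q_{s+1}} ≤ C(s,p,q) ‖|∇u|‖_{L^p_s}` with `c_u = |B_ρ|⁻¹ ∫_{B_ρ} u`
(a formula independent of `s` and `p`); moreover if `p > N` or `p = N = 1` then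
(a representative of) `u` satisfies `|x|^{-(s+1)} u(x) → 0` as `|x| → ∞`. -/
theorem stmt_11 {N : ℕ} (hN : 1 ≤ N) (s p ρ : ℝ) (hs : -1 < s) (hp : 1 ≤ p) (hρ : 0 < ρ) :
    (∀ q ∈ Ijp N 1 p, ∃ C : ℝ, 0 < C ∧
      ∀ (u : Euc N → ℝ) (g : Fin N → Euc N → ℝ),
        (∀ i, IsWeakPartialDeriv i u (g i)) →
        (∀ i, MemLs N s (ENNReal.ofReal p) (g i)) →
        MemLs N (s + 1) q u ∧
          LsNorm N (s + 1) q (fun x => u x - ballAvg ρ u)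
            ≤ C * LsNorm N s (ENNReal.ofReal p) (gradNorm1 g)) ∧
    (((N : ℝ) < p ∨ (p = 1 ∧ N = 1)) →
      ∀ (u : Euc N → ℝ) (g : Fin N → Euc N → ℝ),
        (∀ i, IsWeakPartialDeriv i u (g i)) →
        (∀ i, MemLs N s (ENNReal.ofReal p) (g i)) →
        ∃ v : Euc N → ℝ, v =ᵐ[volume] u ∧
          Tendsto (fun x : Euc N => ‖x‖ ^ (-(s + 1)) * v x) (cocompact (Euc N))
            (nhds 0)) := by
  exact ⟨part1 hN s p ρ hs hp hρ, part2 hN s p ρ hs hp hρ⟩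

end
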